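/- There are at most countably many homeomorphism types of compact topological 4-manifolds: there exists a sequence of topological spaces (X_n)_{n ∈ ℕ}, each a compact topological 4-manifold (possibly with boundary), such that every compact topological 4-manifold M is homeomorphic to X_n for some n. (This is the set-theoretic content of the paper's main theorem: every compact topological 4-manifold is provably specified up to homeomorphism by a finite data structure, i.e., by a finite number of bits, so finite binary certificates surject onto homeomorphism classes.) -/

import Mathlib

/-- A compact topological 4-manifold (possibly with boundary): a compact Hausdorff
second-countable topological space locally homeomorphic to the closed half-space of
dimension 4 (charts in the half-space model cover both interior and boundary points). -/
structure CompactTopFourManifold : Type 1 where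
  carrier : Type
  [top : TopologicalSpace carrier]
  [cpt : CompactSpace carrier]
  [t2 : T2Space carrier]
  [sc : SecondCountableTopology carrier]
  [charts : ChartedSpace (EuclideanHalfSpace 4) carrier]

attribute [instance] CompactTopFourManifold.top CompactTopFourManifold.cpt
  CompactTopFourManifold.t2 CompactTopFourManifold.sc CompactTopFourManifold.charts

namespace TopologicalStability

open Set Filter Topology Metric

/-- `g` restricts to a homeomorphism between a neighbourhood of `x` in `X` and a neighbourhood of
`g x` in `Y`, as far as images of neighbourhoods are concerned. -/
def LocHomeoAt {α β : Type*} [TopologicalSpace α] [TopologicalSpace β] (X : Set α) (Y : Set β)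
    (g : α → β) (x : α) : Prop :=
  g x ∈ Y ∧ map g (𝓝[X] x) = 𝓝[Y] (g x)

namespace LocHomeoAt

variable {α β γ : Type*} [TopologicalSpace α] [TopologicalSpace β] [TopologicalSpace γ]
  {X : Set α} {Y : Set β} {Z : Set γ} {g : α → β} {f : β → γ} {x : α}

theorem tendsto (h : LocHomeoAt X Y g x) : Tendsto g (𝓝[X] x) (𝓝[Y] (g x)) := h.2.le

theorem comp (hf : LocHomeoAt Y Z f (g x)) (hg : LocHomeoAt X Y g x) :
    LocHomeoAt X Z (f ∘ g) x :=
  ⟨hf.1, by rw [← Filter.map_map, hg.2, hf.2]; rfl⟩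

theorem congr {g' : α → β} (h : LocHomeoAt X Y g x) (hx : x ∈ X) (he : g' =ᶠ[𝓝[X] x] g) :
    LocHomeoAt X Y g' x := by
  have e : g' x = g x := he.self_of_nhdsWithin hx
  exact ⟨e ▸ h.1, by rw [Filter.map_congr he, h.2, e]⟩

theorem of_leftInverse {h : β → α} (hg : LocHomeoAt X Y g x) (hx : x ∈ X)
    (he : ∀ᶠ y in 𝓝[X] x, h (g y) = y) : LocHomeoAt Y X h (g x) := by
  have e : h (g x) = x := he.self_of_nhdsWithin hx
  refine ⟨e.symm ▸ hx, ?_⟩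
  rw [← hg.2, Filter.map_map, e]
  exact (Filter.map_congr (f := 𝓝[X] x) (m₂ := id) he).trans Filter.map_id

theorem of_inverse {h : β → α} (hg : Tendsto g (𝓝[X] x) (𝓝[Y] (g x))) (hgx : g x ∈ Y)
    (hh : Tendsto h (𝓝[Y] (g x)) (𝓝[X] x)) (he : ∀ᶠ y in 𝓝[Y] (g x), g (h y) = y) :
    LocHomeoAt X Y g x := by
  refine ⟨hgx, le_antisymm hg ?_⟩
  calc 𝓝[Y] (g x) = map (g ∘ h) (𝓝[Y] (g x)) :=
        ((Filter.map_congr (m₂ := id) he).trans Filter.map_id).symm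
    _ = map g (map h (𝓝[Y] (g x))) := Filter.map_map.symm
    _ ≤ map g (𝓝[X] x) := Filter.map_mono hh

theorem id' {x : α} (hx : x ∈ X) : LocHomeoAt X X (fun y => y) x := ⟨hx, Filter.map_id⟩

theorem image_mem (h : LocHomeoAt X Y g x) {s : Set α} (hs : s ∈ 𝓝[X] x) :
    g '' s ∈ 𝓝[Y] (g x) := h.2 ▸ Filter.image_mem_map hs

end LocHomeoAt

/-- `g` is an embedding of `U ∩ X` onto a relatively open subset of `X`, which moves
points by at most `δ`. -/
structure NearEmb {E : Type*} [PseudoMetricSpace E] (X U : Set E) (g : E → E) (δ : ℝ) :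
    Prop where
  loc : ∀ x ∈ X, x ∈ U → LocHomeoAt X X g x
  near : ∀ x ∈ X, x ∈ U → dist (g x) x ≤ δ
  inj : ∀ x ∈ X, x ∈ U → ∀ y ∈ X, y ∈ U → g x = g y → x = y

namespace NearEmb

variable {E : Type*} [PseudoMetricSpace E] {X U V : Set E} {g : E → E} {δ δ' : ℝ}

theorem mono (h : NearEmb X U g δ) (hV : ∀ x ∈ X, x ∈ V → x ∈ U) (hd : δ ≤ δ') :
    NearEmb X V g δ' where
  loc x hx hxV := h.loc x hx (hV x hx hxV)
  near x hx hxV := (h.near x hx (hV x hx hxV)).trans hd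
  inj x hx hxV y hy hyV := h.inj x hx (hV x hx hxV) y hy (hV y hy hyV)

end NearEmb

/-- The image of a near-identity embedding contains every point that is well inside its domain. -/
theorem NearEmb.exists_preimage {E : Type*} [NormedAddCommGroup E] [NormedSpace ℝ E]
    [ProperSpace E] {X U : Set E} {g : E → E} {δ : ℝ} (hg : NearEmb X U g δ)
    (hXc : Convex ℝ X) (hX : IsClosed X) (hδ : 0 < δ) {y : E} (hy : y ∈ X)
    (hU : ∀ x ∈ X, dist x y ≤ 3 * δ → x ∈ U) : ∃ b ∈ X, b ∈ U ∧ g b = y := by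
  set K := closedBall y (3 * δ) ∩ X with hK
  have hKX : K ⊆ X := inter_subset_right
  have hKU : ∀ x ∈ K, x ∈ U := fun x hx => hU x hx.2 hx.1
  have hKc : IsCompact K := (isCompact_closedBall _ _).inter_right hX
  have hgc : ContinuousOn g K := fun x hx =>
    ((hg.loc x hx.2 (hKU x hx)).tendsto.mono_right nhdsWithin_le_nhds).mono_left
      (nhdsWithin_mono _ hKX)
  have hgK : IsClosed (g '' K) := (hKc.image_of_continuousOn hgc).isClosed
  have hyK : y ∈ K := ⟨mem_closedBall_self (by positivity), hy⟩
  have hgy : dist (g y) y ≤ δ := hg.near y hy (hKU y hyK)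
  have hpre : IsPreconnected (ball y (2 * δ) ∩ X) :=
    ((convex_ball y (2 * δ)).inter hXc).isPreconnected
  suffices y ∈ g '' K by
    obtain ⟨b, hb, e⟩ := this
    exact ⟨b, hb.2, hKU b hb, e⟩
  by_contra hne
  set O := interior (g '' K ∪ Xᶜ) with hO
  have hOsub : O ⊆ g '' K ∪ Xᶜ := interior_subset
  obtain ⟨z, ⟨hzb, hzX⟩, ⟨b, hb, rfl⟩, hzO⟩ := isPreconnected_closed_iff.1 hpre (g '' K) Oᶜ hgK
    isOpen_interior.isClosed_compl
    (by
      rintro z ⟨-, hz⟩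
      by_cases h : z ∈ O
      · exact Or.inl ((hOsub h).resolve_right (fun h' => h' hz))
      · exact Or.inr h)
    ⟨g y, ⟨by rw [mem_ball]; linarith, (hg.loc y hy (hKU y hyK)).1⟩, ⟨y, hyK, rfl⟩⟩
    ⟨y, ⟨mem_ball_self (by positivity), hy⟩, fun h =>
      ((hOsub h).elim hne (fun h' => h' hy))⟩
  apply hzO
  have hbn := hg.near b hb.2 (hKU b hb)
  have hby : dist b y < 3 * δ := by
    have := dist_triangle_left b y (g b)
    rw [mem_ball] at hzb; linarith
  have hKn : K ∈ 𝓝[X] b :=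
    inter_mem (mem_nhdsWithin_of_mem_nhds (closedBall_mem_nhds_of_mem hby)) self_mem_nhdsWithin
  have := (hg.loc b hb.2 (hKU b hb)).image_mem hKn
  rw [hO, mem_interior_iff_mem_nhds]
  rw [mem_nhdsWithin_iff_eventually] at this
  filter_upwards [this] with w hw
  by_cases hwX : w ∈ X
  · exact Or.inl (hw hwX)
  · exact Or.inr hwX

/-- A locally injective map which moves points little is injective. -/
theorem inj_of_near {E : Type*} [PseudoMetricSpace E] {f : E → E} {η : ℝ} {x y : E}
    (hx : dist (f x) x ≤ η) (hy : dist (f y) y ≤ η) (h : f x = f y) : dist x y ≤ 2 * η := by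
  have := dist_triangle_left x y (f x)
  rw [h] at this hx
  linarith

section Orthant

variable {ι : Type*}

/-- The orthant on which the coordinates in `B` are nonnegative. -/
def orthant (B : Set ι) : Set (ι → ℝ) := {x | ∀ i ∈ B, 0 ≤ x i}

theorem convex_orthant (B : Set ι) : Convex ℝ (orthant B) := by
  intro x hx y hy a b ha hb _ i hi
  have := hx i hi
  have := hy i hi
  simp only [Pi.add_apply, Pi.smul_apply, smul_eq_mul]
  positivity

theorem isClosed_orthant (B : Set ι) : IsClosed (orthant B) := by
  have : orthant B = ⋂ i ∈ B, {x | 0 ≤ x i} := by ext; simp [orthant]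
  rw [this]
  exact isClosed_biInter fun i _ => isClosed_le continuous_const (continuous_apply i)

variable [DecidableEq ι]

/-- Apply `h` to the coordinate `i`. -/
def onCoord (i : ι) (h : ℝ → ℝ) (x : ι → ℝ) : ι → ℝ := Function.update x i (h (x i))

@[simp] theorem onCoord_same (i : ι) (h : ℝ → ℝ) (x : ι → ℝ) : onCoord i h x i = h (x i) := by
  simp [onCoord]

theorem onCoord_of_ne {i l : ι} (hl : l ≠ i) (h : ℝ → ℝ) (x : ι → ℝ) :
    onCoord i h x l = x l := by
  simp [onCoord, hl]

theorem onCoord_onCoord (i : ι) (h k : ℝ → ℝ) (x : ι → ℝ) :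
    onCoord i h (onCoord i k x) = onCoord i (fun t => h (k t)) x := by
  simp [onCoord]

theorem onCoord_congr {i : ι} {h k : ℝ → ℝ} {x : ι → ℝ} (e : h (x i) = k (x i)) :
    onCoord i h x = onCoord i k x := by
  simp [onCoord, e]

theorem onCoord_eq_self {i : ι} {h : ℝ → ℝ} {x : ι → ℝ} (e : h (x i) = x i) :
    onCoord i h x = x := by
  simp [onCoord, e]

theorem continuous_onCoord (i : ι) {h : ℝ → ℝ} (hh : Continuous h) :
    Continuous (onCoord i h) := by
  unfold onCoord
  exact continuous_id.update i (hh.comp (continuous_apply i))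

theorem onCoord_mem_orthant {B : Set ι} {i : ι} {h : ℝ → ℝ} {x : ι → ℝ} (hx : x ∈ orthant B)
    (hp : i ∈ B → 0 ≤ h (x i)) : onCoord i h x ∈ orthant B := by
  intro l hl
  by_cases e : l = i
  · subst e; simpa using hp hl
  · rw [onCoord_of_ne e]; exact hx l hl

theorem locHomeoAt_onCoord {B : Set ι} {i : ι} {h k : ℝ → ℝ} (hh : Continuous h)
    (hk : Continuous k) (hkh : ∀ t, k (h t) = t) (hhk : ∀ t, h (k t) = t) {x : ι → ℝ}
    (hx : x ∈ orthant B) (hp : i ∈ B → 0 < x i) (hp' : i ∈ B → 0 < h (x i)) :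
    LocHomeoAt (orthant B) (orthant B) (onCoord i h) x := by
  have key : ∀ (h : ℝ → ℝ), Continuous h → ∀ x ∈ orthant B, (i ∈ B → 0 < h (x i)) →
      Tendsto (onCoord i h) (𝓝[orthant B] x) (𝓝[orthant B] (onCoord i h x)) := by
    intro h hh x hx hp
    refine tendsto_nhdsWithin_iff.2 ⟨((continuous_onCoord i hh).tendsto x).mono_left
      nhdsWithin_le_nhds, ?_⟩
    by_cases hi : i ∈ B
    · have : ∀ᶠ y : ι → ℝ in 𝓝 x, 0 < h (y i) :=
        (hh.comp (continuous_apply i)).continuousAt.eventually (lt_mem_nhds (hp hi))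
      filter_upwards [self_mem_nhdsWithin, mem_nhdsWithin_of_mem_nhds this] with y hy hy'
      exact onCoord_mem_orthant hy fun _ => le_of_lt hy'
    · filter_upwards [self_mem_nhdsWithin] with y hy
      exact onCoord_mem_orthant hy fun h => absurd h hi
  have e : onCoord i k (onCoord i h x) = x := by
    rw [onCoord_onCoord]; exact onCoord_eq_self (hkh _)
  have hX := onCoord_mem_orthant (h := h) hx fun hi => (hp' hi).le
  refine LocHomeoAt.of_inverse (h := onCoord i k) (key h hh x hx hp') hX ?_ ?_
  · have := key k hk (onCoord i h x) hX (fun hi => by simpa [hkh] using hp hi)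
    rwa [e] at this
  · filter_upwards with y
    rw [onCoord_onCoord]; exact onCoord_eq_self (hhk _)

theorem dist_onCoord_le [Fintype ι] (i : ι) {h : ℝ → ℝ} {x y : ι → ℝ} {c : ℝ}
    (hxy : dist x y ≤ c) (hh : dist (h (x i)) (h (y i)) ≤ c) :
    dist (onCoord i h x) (onCoord i h y) ≤ c := by
  have hc : 0 ≤ c := dist_nonneg.trans hxy
  refine (dist_pi_le_iff hc).2 fun l => ?_
  by_cases e : l = i
  · subst e; simpa using hh
  · rw [onCoord_of_ne e, onCoord_of_ne e]; exact (dist_le_pi_dist x y l).trans hxy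

omit [DecidableEq ι] in
theorem abs_sub_le_of_dist_le [Fintype ι] {x y : ι → ℝ} {c : ℝ} (h : dist x y ≤ c) (l : ι) :
    |x l - y l| ≤ c := (dist_le_pi_dist x y l).trans h

end Orthant

/-- An increasing homeomorphism of the line which is `t + 4` for `t ≤ 3 / 2` and `t` for
`t ≥ 13 / 2`. -/
noncomputable def pushUp (t : ℝ) : ℝ := max (min (t + 4) (26 / 5 + t / 5)) t

/-- The inverse of `pushUp`. -/
noncomputable def pushDown (t : ℝ) : ℝ := min (max (t - 4) (5 * t - 26)) t

theorem continuous_pushUp : Continuous pushUp := by unfold pushUp; fun_prop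

theorem continuous_pushDown : Continuous pushDown := by unfold pushDown; fun_prop

theorem pushUp_pushDown (t : ℝ) : pushUp (pushDown t) = t := by
  simp only [pushUp, pushDown, max_def, min_def]
  split_ifs <;> linarith

theorem pushDown_pushUp (t : ℝ) : pushDown (pushUp t) = t := by
  simp only [pushUp, pushDown, max_def, min_def]
  split_ifs <;> linarith

theorem pushDown_of_le {t : ℝ} (h : t ≤ 11 / 2) : pushDown t = t - 4 := by
  simp only [pushDown, max_def, min_def]
  split_ifs <;> linarith

theorem pushDown_of_ge {t : ℝ} (h : 13 / 2 ≤ t) : pushDown t = t := by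
  simp only [pushDown, max_def, min_def]
  split_ifs <;> linarith

theorem pushDown_le (t : ℝ) : pushDown t ≤ t := min_le_right _ _

theorem sub_four_le_pushDown (t : ℝ) : t - 4 ≤ pushDown t := by
  simp only [pushDown, max_def, min_def]
  split_ifs <;> linarith

theorem pushUp_of_le {t : ℝ} (h : t ≤ 3 / 2) : pushUp t = t + 4 := by
  simp only [pushUp, max_def, min_def]
  split_ifs <;> linarith

theorem pushUp_of_ge {t : ℝ} (h : 13 / 2 ≤ t) : pushUp t = t := by
  simp only [pushUp, max_def, min_def]
  split_ifs <;> linarith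

theorem pushUp_le (t : ℝ) : pushUp t ≤ t + 4 := by
  simp only [pushUp, max_def, min_def]
  split_ifs <;> linarith

theorem lt_pushUp {t : ℝ} (h : 4 / 5 < t) : 24 / 5 < pushUp t := by
  simp only [pushUp, max_def, min_def]
  split_ifs <;> linarith

theorem abs_pushUp_sub_le (s t : ℝ) : |pushUp s - pushUp t| ≤ |s - t| := by
  simp only [pushUp, max_def, min_def]
  rw [abs_le]
  rcases abs_cases (s - t) with h | h <;> constructor <;> split_ifs <;> linarith

section Furl

variable {ι : Type*}

/-- The box with lower constraints on the coordinates in `L` and upper constraints on those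
in `R`. -/
def slab (L R : Set ι) (s : ℝ) : Set (ι → ℝ) :=
  {x | (∀ l ∈ L, -s < x l) ∧ ∀ l ∈ R, x l < s}

theorem isOpen_slab [Finite ι] (L R : Set ι) (s : ℝ) : IsOpen (slab L R s) := by
  have : slab L R s = (⋂ l ∈ L, {x | -s < x l}) ∩ ⋂ l ∈ R, {x | x l < s} := by
    ext; simp [slab]
  rw [this]
  exact (L.toFinite.isOpen_biInter fun l _ => isOpen_lt continuous_const (continuous_apply l)).inter
    (R.toFinite.isOpen_biInter fun l _ => isOpen_lt (continuous_apply l) continuous_const)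

variable [Fintype ι]

theorem slab_of_dist {L R : Set ι} {s s' c : ℝ} {x y : ι → ℝ} (hx : x ∈ slab L R s)
    (hxy : dist y x ≤ c) (hs : s + c ≤ s') : y ∈ slab L R s' := by
  constructor <;> intro l hl <;> have := abs_le.1 (abs_sub_le_of_dist_le hxy l)
  · have := hx.1 l hl; linarith
  · have := hx.2 l hl; linarith

theorem slab_insert_of_dist {L R : Set ι} {i : ι} {s s' c : ℝ} {x y : ι → ℝ}
    (hx : x ∈ slab L R s) (hxy : dist y x ≤ c) (hs : s + c ≤ s') (hi : x i + c < s') :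
    y ∈ slab L (insert i R) s' := by
  refine ⟨(slab_of_dist hx hxy hs).1, ?_⟩
  rintro l (rfl | hl)
  · have := abs_le.1 (abs_sub_le_of_dist_le hxy l); linarith
  · exact (slab_of_dist hx hxy hs).2 l hl

variable [DecidableEq ι]

omit [Fintype ι] in
theorem onCoord_mem_slab {L R : Set ι} {i : ι} {s : ℝ} {h : ℝ → ℝ} {x : ι → ℝ}
    (hx : x ∈ slab L R s) (hi : i ∉ R) (hs : -s < h (x i)) : onCoord i h x ∈ slab L R s := by
  constructor <;> intro l hl <;> by_cases e : l = i
  · subst e; simpa using hs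
  · rw [onCoord_of_ne e]; exact hx.1 l hl
  · subst e; exact absurd hl hi
  · rw [onCoord_of_ne e]; exact hx.2 l hl

omit [Fintype ι] in
theorem onCoord_injective {i : ι} {h k : ℝ → ℝ} (hkh : ∀ t, k (h t) = t) :
    Function.Injective (onCoord i h) := by
  refine Function.LeftInverse.injective (g := onCoord i k) fun x => ?_
  rw [onCoord_onCoord]; exact onCoord_eq_self (hkh _)

/-- The map that interpolates between the identity and the shifted embedding. -/
theorem exists_twist {B L R : Set ι} {i : ι} (hi : i ∉ R) {a δ : ℝ} (ha : 10 ≤ a) (hδ : 0 < δ)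
    (hδ' : δ ≤ 1 / 100) {g : (ι → ℝ) → ι → ℝ}
    (hg : NearEmb (orthant B) (slab L (insert i R) a) g δ) :
    ∃ F : (ι → ℝ) → ι → ℝ,
      NearEmb (orthant B) {z | z ∈ slab L R (a - 9 / 10) ∧ 49 / 10 < z i ∧ z i < 91 / 10} F
        (2 * δ) ∧
      (∀ z ∈ orthant B, z ∈ slab L R (a - 9 / 10) → 49 / 10 < z i → z i < 27 / 5 → F z = z) ∧
      (∀ x ∈ orthant B, x ∈ slab L R (a - 1) → 131 / 20 ≤ x i → x i < 9 →
        F (g x) = onCoord i (· + 4) (g (onCoord i (· + -4) x))) ∧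
      ∀ Z : Set (ι → ℝ), (∀ h, ∀ x ∈ Z, onCoord i h x ∈ Z) →
        (∀ x ∈ orthant B, x ∈ slab L (insert i R) a → x ∈ Z → g x = x) →
        ∀ z ∈ orthant B, z ∈ slab L R (a - 9 / 10) → 49 / 10 < z i → z i < 91 / 10 → z ∈ Z →
          F z = z := by
  classical
  set X := orthant B with hX
  set U := slab L (insert i R) a with hU
  set q : ℝ → ℝ := fun t => pushUp t - 4 with hq
  set gi := Function.invFunOn g (X ∩ U) with hgi
  have gi_left : ∀ x ∈ X, x ∈ U → gi (g x) = x := by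
    intro x hx hxU
    have hex : ∃ y ∈ X ∩ U, g y = g x := ⟨x, ⟨hx, hxU⟩, rfl⟩
    have h1 := Function.invFunOn_mem hex
    exact hg.inj _ h1.1 h1.2 _ hx hxU (Function.invFunOn_eq hex)
  set A : Set (ι → ℝ) := {z | z ∈ slab L R (a - 9 / 10) ∧ 49 / 10 < z i ∧ z i < 91 / 10} with hA
  set w : (ι → ℝ) → ι → ℝ := onCoord i pushDown with hw
  set F : (ι → ℝ) → ι → ℝ := fun z => onCoord i (· + 4) (g (onCoord i q (gi (w z)))) with hF
  have w_bd : ∀ z ∈ A, 9 / 10 < w z i ∧ w z i < 91 / 10 := by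
    intro z hz
    have h1 := sub_four_le_pushDown (z i)
    have h2 := pushDown_le (z i)
    have h3 := hz.2
    simp only [hw, onCoord_same]
    constructor <;> linarith
  have w_mem : ∀ z ∈ X, z ∈ A → w z ∈ X ∧ w z ∈ slab L R (a - 9 / 10) := by
    intro z hzX hz
    have := w_bd z hz
    simp only [hw, onCoord_same] at this
    exact ⟨onCoord_mem_orthant hzX fun _ => by linarith, onCoord_mem_slab hz.1 hi (by linarith)⟩
  have gi_spec : ∀ z ∈ X, z ∈ A → gi (w z) ∈ X ∧ gi (w z) ∈ U ∧ g (gi (w z)) = w z := by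
    intro z hzX hz
    have hb := w_bd z hz
    obtain ⟨b, hb1, hb2, hb3⟩ := hg.exists_preimage (convex_orthant B) (isClosed_orthant B) hδ
      (w_mem z hzX hz).1 (fun x _ hx' =>
        slab_insert_of_dist (w_mem z hzX hz).2 hx' (by linarith) (by linarith))
    have : gi (w z) = b := by rw [← hb3]; exact gi_left b hb1 hb2
    rw [this]; exact ⟨hb1, hb2, hb3⟩
  have gi_dist : ∀ z ∈ X, z ∈ A → dist (gi (w z)) (w z) ≤ δ := by
    intro z hzX hz
    obtain ⟨h1, h2, h3⟩ := gi_spec z hzX hz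
    have := hg.near _ h1 h2
    rwa [h3, dist_comm] at this
  have v_bd : ∀ z ∈ X, z ∈ A → 22 / 25 < gi (w z) i ∧ gi (w z) i < 93 / 10 := by
    intro z hzX hz
    have h1 := abs_le.1 (abs_sub_le_of_dist_le (gi_dist z hzX hz) i)
    have h2 := w_bd z hz
    constructor <;> linarith
  have y_mem : ∀ z ∈ X, z ∈ A → onCoord i q (gi (w z)) ∈ X ∧ onCoord i q (gi (w z)) ∈ U ∧
      4 / 5 < q (gi (w z) i) := by
    intro z hzX hz
    obtain ⟨h1, h2, -⟩ := gi_spec z hzX hz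
    obtain ⟨b1, b2⟩ := v_bd z hzX hz
    have h4 : 4 / 5 < q (gi (w z) i) := by
      have := lt_pushUp (t := gi (w z) i) (by linarith); simp only [hq]; linarith
    have h5 : q (gi (w z) i) ≤ gi (w z) i := by
      have := pushUp_le (gi (w z) i); simp only [hq]; linarith
    refine ⟨onCoord_mem_orthant h1 fun _ => by linarith, ⟨?_, ?_⟩, h4⟩ <;> intro l hl <;>
      by_cases e : l = i
    · subst e; rw [onCoord_same]; linarith
    · rw [onCoord_of_ne e]; exact h2.1 l hl
    · subst e; rw [onCoord_same]; linarith
    · rw [onCoord_of_ne e]; exact h2.2 l hl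
  have gy_bd : ∀ z ∈ X, z ∈ A → 7 / 10 < g (onCoord i q (gi (w z))) i := by
    intro z hzX hz
    obtain ⟨h1, h2, h3⟩ := y_mem z hzX hz
    have := abs_le.1 (abs_sub_le_of_dist_le (hg.near _ h1 h2) i)
    rw [onCoord_same] at this
    linarith
  have q_inv1 : ∀ t, pushDown (q t + 4) = t := fun t => by simp [hq, pushDown_pushUp]
  have q_inv2 : ∀ t, q (pushDown (t + 4)) = t := fun t => by simp [hq, pushUp_pushDown]
  have q_cont : Continuous q := continuous_pushUp.sub continuous_const
  refine ⟨F, ⟨?_, ?_, ?_⟩, ?_, ?_, ?_⟩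
  · intro z hzX hz
    have hwz : 0 < pushDown (z i) := by
      have := (w_bd z hz).1; simp only [hw, onCoord_same] at this; linarith
    have l1 : LocHomeoAt X X w z := locHomeoAt_onCoord continuous_pushDown continuous_pushUp
      pushUp_pushDown pushDown_pushUp hzX (fun _ => by linarith [hz.2.1]) fun _ => hwz
    obtain ⟨h1, h2, h3⟩ := gi_spec z hzX hz
    have l2 : LocHomeoAt X X gi (w z) := by
      rw [← h3]
      refine (hg.loc _ h1 h2).of_leftInverse h1 ?_
      filter_upwards [self_mem_nhdsWithin,
        mem_nhdsWithin_of_mem_nhds ((isOpen_slab _ _ _).mem_nhds h2)] with y hy hy'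
      exact gi_left y hy hy'
    obtain ⟨y1, y2, y3⟩ := y_mem z hzX hz
    have l3 : LocHomeoAt X X (onCoord i q) (gi (w z)) :=
      locHomeoAt_onCoord (k := fun t => pushDown (t + 4)) q_cont
        (continuous_pushDown.comp (continuous_add_const 4)) q_inv1 q_inv2 h1
        (fun _ => by linarith [v_bd z hzX hz]) fun _ => by linarith
    have l4 := hg.loc _ y1 y2
    have l5 : LocHomeoAt X X (onCoord i (· + 4)) (g (onCoord i q (gi (w z)))) :=
      locHomeoAt_onCoord (k := (· + -4)) (continuous_add_const 4) (continuous_add_const _)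
        (fun t => by ring) (fun t => by ring) l4.1 (fun _ => by linarith [gy_bd z hzX hz])
        fun _ => by linarith [gy_bd z hzX hz]
    exact (((l5.comp l4).comp l3).comp l2).comp l1
  · intro z hzX hz
    obtain ⟨y1, y2, y3⟩ := y_mem z hzX hz
    have e : z = onCoord i (· + 4) (onCoord i q (w z)) := by
      simp only [hw, onCoord_onCoord]
      exact (onCoord_eq_self (by simp [hq, pushUp_pushDown])).symm
    have d1 := hg.near _ y1 y2
    have d2 : dist (onCoord i q (gi (w z))) (onCoord i q (w z)) ≤ δ := by
      refine dist_onCoord_le i (gi_dist z hzX hz) ?_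
      rw [Real.dist_eq]
      simp only [hq, sub_sub_sub_cancel_right]
      exact (abs_pushUp_sub_le _ _).trans (abs_sub_le_of_dist_le (gi_dist z hzX hz) i)
    have d3 : dist (g (onCoord i q (gi (w z)))) (onCoord i q (w z)) ≤ 2 * δ := by
      have := dist_triangle (g (onCoord i q (gi (w z)))) (onCoord i q (gi (w z)))
        (onCoord i q (w z))
      linarith
    conv_lhs => rw [e]
    refine dist_onCoord_le i ?_ ?_
    · rwa [← e]
    · rw [← e, Real.dist_eq, add_sub_add_right_eq_sub]
      exact abs_sub_le_of_dist_le d3 i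
  · intro z hzX hz z' hzX' hz' h
    have e1 := onCoord_injective (i := i) (h := (· + 4)) (k := (· + -4)) (fun t => by ring) h
    obtain ⟨y1, y2, y3⟩ := y_mem z hzX hz
    obtain ⟨y1', y2', y3'⟩ := y_mem z' hzX' hz'
    have e2 := onCoord_injective (i := i) (h := q) (k := fun t => pushDown (t + 4)) q_inv1
      (hg.inj _ y1 y2 _ y1' y2' e1)
    have e3 : w z = w z' := by
      rw [← (gi_spec z hzX hz).2.2, ← (gi_spec z' hzX' hz').2.2, e2]
    exact onCoord_injective pushUp_pushDown e3
  · intro z hzX hzs h1 h2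
    have hz : z ∈ A := ⟨hzs, h1, by linarith⟩
    have e1 : w z i < 7 / 5 := by
      simp only [hw, onCoord_same]; rw [pushDown_of_le (by linarith)]; linarith
    have e2 : gi (w z) i < 3 / 2 := by
      have := abs_le.1 (abs_sub_le_of_dist_le (gi_dist z hzX hz) i); linarith
    have e3 : onCoord i q (gi (w z)) = gi (w z) :=
      onCoord_eq_self (by simp only [hq]; rw [pushUp_of_le e2.le]; ring)
    simp only [hF]
    rw [e3, (gi_spec z hzX hz).2.2]
    simp only [hw, onCoord_onCoord]
    exact onCoord_eq_self (by rw [pushDown_of_le (by linarith)]; ring)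
  · intro x hxX hxs h1 h2
    have hxU : x ∈ U := slab_insert_of_dist (c := 0) hxs (by simp) (by linarith) (by linarith)
    have b := abs_le.1 (abs_sub_le_of_dist_le (hg.near x hxX hxU) i)
    have e1 : w (g x) = g x := onCoord_eq_self (pushDown_of_ge (by linarith))
    simp only [hF]
    rw [e1, gi_left x hxX hxU]
    congr 2
    exact onCoord_congr (by simp only [hq]; rw [pushUp_of_ge (by linarith)]; ring)
  · intro Z hZ hgZ z hzX hzs h1 h2 hzZ
    have hz : z ∈ A := ⟨hzs, h1, h2⟩
    have e1 : gi (w z) = w z := by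
      have hwU : w z ∈ U := slab_insert_of_dist (c := 0) (w_mem z hzX hz).2 (by simp)
        (by linarith) (by linarith [w_bd z hz])
      have := gi_left _ (w_mem z hzX hz).1 hwU
      rwa [hgZ _ (w_mem z hzX hz).1 hwU (hZ _ _ hzZ)] at this
    obtain ⟨y1, y2, -⟩ := y_mem z hzX hz
    rw [e1] at y1 y2
    simp only [hF]
    rw [e1, hgZ _ y1 y2 (hZ _ _ (hZ _ _ hzZ))]
    simp only [hw, onCoord_onCoord]
    exact onCoord_eq_self (by simp [hq, pushUp_pushDown])

end Furl

section Furl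

variable {ι : Type*} [Fintype ι] [DecidableEq ι]

/-- An embedding which is equivariant under the shift by `4` on its upper end. -/
theorem exists_equivariant_end {B L R : Set ι} {i : ι} (hi : i ∉ R) {a δ : ℝ} (ha : 10 ≤ a)
    (hδ : 0 < δ) (hδ' : δ ≤ 1 / 100) {g : (ι → ℝ) → ι → ℝ}
    (hg : NearEmb (orthant B) (slab L (insert i R) a) g δ) :
    ∃ ψ : (ι → ℝ) → ι → ℝ,
      NearEmb (orthant B) {x | x ∈ slab L R (a - 1) ∧ x i < 9} ψ (3 * δ) ∧
      (∀ x ∈ orthant B, x ∈ slab L R (a - 1) → x i < 53 / 10 → ψ x = g x) ∧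
      (∀ x ∈ orthant B, x ∈ slab L R (a - 1) → 33 / 5 ≤ x i → x i < 9 →
        ψ x = onCoord i (· + 4) (ψ (onCoord i (· + -4) x))) ∧
      ∀ Z : Set (ι → ℝ), (∀ h, ∀ x ∈ Z, onCoord i h x ∈ Z) →
        (∀ x ∈ orthant B, x ∈ slab L (insert i R) a → x ∈ Z → g x = x) →
        ∀ x ∈ orthant B, x ∈ slab L R (a - 1) → x i < 9 → x ∈ Z → ψ x = x := by
  classical
  obtain ⟨F, hF, hF1, hF2, hF3⟩ := exists_twist hi ha hδ hδ' hg
  set X := orthant B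
  set ψ : (ι → ℝ) → ι → ℝ := fun x => if g x i < 26 / 5 then g x else F (g x) with hψ
  have hU : ∀ x, x ∈ slab L R (a - 1) → x i < 9 → x ∈ slab L (insert i R) a :=
    fun x h1 h2 => slab_insert_of_dist (c := 0) h1 (by simp) (by linarith) (by linarith)
  have hgi : ∀ x ∈ X, x ∈ slab L R (a - 1) → x i < 9 → -δ ≤ g x i - x i ∧ g x i - x i ≤ δ :=
    fun x hx h1 h2 => abs_le.1 (abs_sub_le_of_dist_le (hg.near x hx (hU x h1 h2)) i)
  have hgs : ∀ x ∈ X, x ∈ slab L R (a - 1) → x i < 9 → g x ∈ X ∧ g x ∈ slab L R (a - 9 / 10) :=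
    fun x hx h1 h2 => ⟨(hg.loc x hx (hU x h1 h2)).1,
      slab_of_dist h1 (hg.near x hx (hU x h1 h2)) (by linarith)⟩
  have low : ∀ x ∈ X, x ∈ slab L R (a - 1) → x i < 53 / 10 → ψ x = g x := by
    intro x hx h1 h2
    have h3 := hgi x hx h1 (by linarith)
    simp only [hψ]
    split_ifs with h
    · rfl
    · exact hF1 _ (hgs x hx h1 (by linarith)).1 (hgs x hx h1 (by linarith)).2 (by linarith)
        (by linarith)
  have high : ∀ x ∈ X, x ∈ slab L R (a - 1) → 99 / 20 < x i → x i < 9 → ψ x = F (g x) := by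
    intro x hx h1 h2 h2'
    have h3 := hgi x hx h1 h2'
    simp only [hψ]
    split_ifs with h
    · exact (hF1 _ (hgs x hx h1 (by linarith)).1 (hgs x hx h1 (by linarith)).2 (by linarith)
        (by linarith)).symm
    · rfl
  have hA : ∀ x ∈ X, x ∈ slab L R (a - 1) → 99 / 20 < x i → x i < 9 →
      g x ∈ {z | z ∈ slab L R (a - 9 / 10) ∧ 49 / 10 < z i ∧ z i < 91 / 10} := by
    intro x hx h1 h2 h3
    have h4 := hgi x hx h1 h3
    exact ⟨(hgs x hx h1 h3).2, by linarith, by linarith⟩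
  have hnear : ∀ x ∈ X, x ∈ {x | x ∈ slab L R (a - 1) ∧ x i < 9} → dist (ψ x) x ≤ 3 * δ := by
    rintro x hx ⟨h1, h2⟩
    have h3 := hg.near x hx (hU x h1 h2)
    rcases lt_or_ge (x i) (53 / 10) with h | h
    · rw [low x hx h1 h]; linarith
    · rw [high x hx h1 (by linarith) h2]
      have := hF.near _ (hgs x hx h1 h2).1 (hA x hx h1 (by linarith) h2)
      have := dist_triangle (F (g x)) (g x) x
      linarith
  refine ⟨ψ, ⟨?_, hnear, ?_⟩, low, ?_, ?_⟩
  · rintro x hx ⟨h1, h2⟩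
    have e1 : ∀ᶠ y in 𝓝[X] x, y ∈ slab L R (a - 1) :=
      mem_nhdsWithin_of_mem_nhds ((isOpen_slab _ _ _).mem_nhds h1)
    have ec : ∀ c, x i < c → ∀ᶠ y in 𝓝[X] x, y i < c := fun c hc =>
      mem_nhdsWithin_of_mem_nhds ((continuous_apply i).continuousAt.eventually (gt_mem_nhds hc))
    rcases lt_or_ge (x i) (53 / 10) with h | h
    · refine (hg.loc x hx (hU x h1 h2)).congr hx ?_
      filter_upwards [self_mem_nhdsWithin, e1, ec _ h] with y hy hy1 hy2
      exact low y hy hy1 hy2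
    · have h' : 99 / 20 < x i := by linarith
      refine ((hF.loc _ (hgs x hx h1 h2).1 (hA x hx h1 h' h2)).comp
        (hg.loc x hx (hU x h1 h2))).congr hx ?_
      filter_upwards [self_mem_nhdsWithin, e1, ec _ h2, mem_nhdsWithin_of_mem_nhds
        ((continuous_apply i).continuousAt.eventually (lt_mem_nhds h'))] with y hy hy1 hy2 hy3
      exact high y hy hy1 hy3 hy2
  · rintro x hx hxV y hy hyV h
    have d := abs_le.1 (abs_sub_le_of_dist_le (inj_of_near (hnear x hx hxV) (hnear y hy hyV) h) i)
    obtain ⟨h1, h2⟩ := hxV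
    obtain ⟨k1, k2⟩ := hyV
    refine hg.inj x hx (hU x h1 h2) y hy (hU y k1 k2) ?_
    rcases lt_or_ge (x i) (26 / 5) with h' | h'
    · rwa [low x hx h1 (by linarith), low y hy k1 (by linarith)] at h
    · have hx' : 99 / 20 < x i := by linarith
      have hy' : 99 / 20 < y i := by linarith
      rw [high x hx h1 hx' h2, high y hy k1 hy' k2] at h
      exact hF.inj _ (hgs x hx h1 h2).1 (hA x hx h1 hx' h2) _ (hgs y hy k1 k2).1
        (hA y hy k1 hy' k2) h
  · intro x hx h1 h2 h3
    rw [high x hx h1 (by linarith) h3, hF2 x hx h1 (by linarith) h3, low]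
    · exact onCoord_mem_orthant hx fun _ => by linarith
    · exact onCoord_mem_slab h1 hi (by linarith)
    · rw [onCoord_same]; linarith
  · intro Z hZ hgZ x hx h1 h2 hxZ
    have e := hgZ x hx (hU x h1 h2) hxZ
    rcases lt_or_ge (x i) (53 / 10) with h | h
    · rw [low x hx h1 h, e]
    · rw [high x hx h1 (by linarith) h2, e]
      have := hA x hx h1 (by linarith) h2
      rw [e] at this
      exact hF3 Z hZ hgZ x hx this.1 this.2.1 this.2.2 hxZ

/-- Removal of an upper constraint from the domain of a near-identity embedding. -/
theorem NearEmb.furl {B L R : Set ι} {i : ι} (hi : i ∉ R) {a δ : ℝ} (ha : 10 ≤ a)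
    (hδ : 0 < δ) (hδ' : δ ≤ 1 / 100) {g : (ι → ℝ) → ι → ℝ}
    (hg : NearEmb (orthant B) (slab L (insert i R) a) g δ) :
    ∃ Φ : (ι → ℝ) → ι → ℝ,
      NearEmb (orthant B) (slab L R (a - 1)) Φ (3 * δ) ∧
      (∀ x ∈ orthant B, x ∈ slab L R (a - 1) → x i < 5 → Φ x = g x) ∧
      ∀ Z : Set (ι → ℝ), (∀ h, ∀ x ∈ Z, onCoord i h x ∈ Z) →
        (∀ x ∈ orthant B, x ∈ slab L (insert i R) a → x ∈ Z → g x = x) →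
        ∀ x ∈ orthant B, x ∈ slab L R (a - 1) → x ∈ Z → Φ x = x := by
  classical
  obtain ⟨ψ, hψ, hψ1, hψ2, hψ3⟩ := exists_equivariant_end hi ha hδ hδ' hg
  set X := orthant B
  set P : ℕ → (ι → ℝ) → ι → ℝ := fun k x =>
    onCoord i (· + 4 * (k : ℝ)) (ψ (onCoord i (· + -(4 * (k : ℝ))) x)) with hP
  set m : (ι → ℝ) → ℕ := fun x => ⌊(x i - 4) / 4⌋₊ with hm
  set Φ : (ι → ℝ) → ι → ℝ := fun x => P (m x) x with hΦ
  have m_ub : ∀ x : ι → ℝ, x i - 4 * (m x : ℝ) < 8 := by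
    intro x
    have := Nat.lt_floor_add_one ((x i - 4) / 4)
    simp only [hm]; linarith
  have m_lb : ∀ x : ι → ℝ, m x ≠ 0 → 4 ≤ x i - 4 * (m x : ℝ) := by
    intro x h
    have := Nat.floor_le (a := (x i - 4) / 4) (by
      by_contra h'
      exact h (Nat.floor_of_nonpos (not_le.1 h').le))
    simp only [hm]; linarith
  have P_zero : ∀ x, P 0 x = ψ x := by
    intro x
    simp only [hP]
    rw [onCoord_eq_self (by simp), onCoord_eq_self (by simp)]
  -- the shifted point lies in the domain of `ψ`
  have sh_mem : ∀ (k : ℕ), ∀ x ∈ X, x ∈ slab L R (a - 1) → (k ≠ 0 → 13 / 5 ≤ x i - 4 * (k : ℝ)) →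
      onCoord i (· + -(4 * (k : ℝ))) x ∈ X ∧
      onCoord i (· + -(4 * (k : ℝ))) x ∈ slab L R (a - 1) := by
    intro k x hx hxs h
    rcases eq_or_ne k 0 with rfl | hk
    · rw [onCoord_eq_self (by simp)]; exact ⟨hx, hxs⟩
    · have := h hk
      exact ⟨onCoord_mem_orthant hx fun _ => by linarith, onCoord_mem_slab hxs hi (by linarith)⟩
  have P_succ : ∀ (k : ℕ), ∀ x ∈ X, x ∈ slab L R (a - 1) → 33 / 5 ≤ x i - 4 * (k : ℝ) →
      x i - 4 * (k : ℝ) < 9 → P k x = P (k + 1) x := by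
    intro k x hx hxs h1 h2
    obtain ⟨e1, e2⟩ := sh_mem k x hx hxs (fun _ => by linarith)
    simp only [hP]
    rw [hψ2 _ e1 e2 (by rw [onCoord_same]; linarith) (by rw [onCoord_same]; linarith)]
    simp only [onCoord_onCoord]
    have : onCoord i (fun t => t + -(4 * (k : ℝ)) + -4) x
        = onCoord i (fun t => t + -(4 * ((k + 1 : ℕ) : ℝ))) x :=
      onCoord_congr (by push_cast; ring)
    rw [this]
    exact onCoord_congr (by push_cast; ring)
  have Φ_eq : ∀ (k : ℕ), ∀ x ∈ X, x ∈ slab L R (a - 1) →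
      (k ≠ 0 → 13 / 5 ≤ x i - 4 * (k : ℝ)) → x i - 4 * (k : ℝ) < 9 → Φ x = P k x := by
    intro k x hx hxs h1 h2
    have u := m_ub x
    have l := m_lb x
    simp only [hΦ]
    rcases lt_trichotomy (m x) k with h | h | h
    · have hk := h1 (by omega)
      have : k = m x + 1 := by
        by_contra h'
        have : (m x : ℝ) + 2 ≤ k := by exact_mod_cast (by omega : m x + 2 ≤ k)
        linarith
      subst this
      push_cast at hk
      exact P_succ _ x hx hxs (by linarith) (by linarith)
    · rw [h]
    · have l' := l (by omega)
      have : m x = k + 1 := by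
        by_contra h'
        have : (k : ℝ) + 2 ≤ m x := by exact_mod_cast (by omega : k + 2 ≤ m x)
        linarith
      rw [this] at l' ⊢
      push_cast at l'
      exact (P_succ _ x hx hxs (by linarith) (by linarith)).symm
  have P_near : ∀ (k : ℕ), ∀ x ∈ X, x ∈ slab L R (a - 1) →
      (k ≠ 0 → 13 / 5 ≤ x i - 4 * (k : ℝ)) → x i - 4 * (k : ℝ) < 9 →
      dist (P k x) x ≤ 3 * δ := by
    intro k x hx hxs h1 h2
    obtain ⟨e1, e2⟩ := sh_mem k x hx hxs h1
    have d := hψ.near _ e1 ⟨e2, by rw [onCoord_same]; linarith⟩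
    have e : x = onCoord i (· + 4 * (k : ℝ)) (onCoord i (· + -(4 * (k : ℝ))) x) := by
      rw [onCoord_onCoord]; exact (onCoord_eq_self (by ring)).symm
    conv_lhs => rw [e]
    refine dist_onCoord_le i ?_ ?_
    · rwa [← e]
    · rw [← e, Real.dist_eq, add_sub_add_right_eq_sub]
      exact abs_sub_le_of_dist_le d i
  have Φ_near : ∀ x ∈ X, x ∈ slab L R (a - 1) → dist (Φ x) x ≤ 3 * δ := fun x hx hxs =>
    P_near (m x) x hx hxs (fun h => by linarith [m_lb x h]) (by linarith [m_ub x])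
  refine ⟨Φ, ⟨?_, Φ_near, ?_⟩, ?_, ?_⟩
  · intro x hx hxs
    have u := m_ub x
    have l := m_lb x
    obtain ⟨e1, e2⟩ := sh_mem (m x) x hx hxs (fun h => by linarith [l h])
    have hloc := hψ.loc _ e1 ⟨e2, by rw [onCoord_same]; linarith⟩
    have hd := abs_le.1 (abs_sub_le_of_dist_le
      (hψ.near _ e1 ⟨e2, by rw [onCoord_same]; linarith⟩) i)
    rw [onCoord_same] at hd
    have main : LocHomeoAt X X (P (m x)) x := by
      rcases eq_or_ne (m x) 0 with h0 | h0
      · have : P (m x) = ψ := by rw [h0]; exact funext P_zero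
        rw [this]
        rw [h0, onCoord_eq_self (by simp)] at hloc
        exact hloc
      · have l' := l h0
        have hm0 : (0 : ℝ) ≤ m x := Nat.cast_nonneg _
        have l1 : LocHomeoAt X X (onCoord i (· + -(4 * (m x : ℝ)))) x :=
          locHomeoAt_onCoord (k := (· + 4 * (m x : ℝ))) (continuous_add_const _)
            (continuous_add_const _) (fun t => by ring) (fun t => by ring) hx
            (fun _ => by linarith) fun _ => by linarith
        have l3 : LocHomeoAt X X (onCoord i (· + 4 * (m x : ℝ)))
            (ψ (onCoord i (· + -(4 * (m x : ℝ))) x)) :=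
          locHomeoAt_onCoord (k := (· + -(4 * (m x : ℝ)))) (continuous_add_const _)
            (continuous_add_const _) (fun t => by ring) (fun t => by ring) hloc.1
            (fun _ => by linarith) fun _ => by linarith
        exact (l3.comp hloc).comp l1
    refine main.congr hx ?_
    have ec : ∀ᶠ y in 𝓝[X] x, y i < x i + 1 / 10 := mem_nhdsWithin_of_mem_nhds
      ((continuous_apply i).continuousAt.eventually (gt_mem_nhds (by linarith)))
    have ec' : ∀ᶠ y in 𝓝[X] x, x i - 1 / 10 < y i := mem_nhdsWithin_of_mem_nhds
      ((continuous_apply i).continuousAt.eventually (lt_mem_nhds (by linarith)))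
    filter_upwards [self_mem_nhdsWithin, mem_nhdsWithin_of_mem_nhds
      ((isOpen_slab _ _ _).mem_nhds hxs), ec, ec'] with y hy hys h1 h2
    exact Φ_eq _ y hy hys (fun h => by linarith [l h]) (by linarith)
  · intro x hx hxs y hy hys h
    have d := abs_le.1 (abs_sub_le_of_dist_le
      (inj_of_near (Φ_near x hx hxs) (Φ_near y hy hys) h) i)
    have u := m_ub x
    have l := m_lb x
    have hk : m x ≠ 0 → 13 / 5 ≤ y i - 4 * (m x : ℝ) := fun h => by linarith [l h]
    have hk' : m x ≠ 0 → 13 / 5 ≤ x i - 4 * (m x : ℝ) := fun h => by linarith [l h]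
    have hu : y i - 4 * (m x : ℝ) < 9 := by linarith
    rw [Φ_eq (m x) y hy hys hk hu] at h
    have h1 := onCoord_injective (i := i) (h := (· + 4 * (m x : ℝ)))
      (k := (· + -(4 * (m x : ℝ)))) (fun t => by ring) h
    obtain ⟨e1, e2⟩ := sh_mem (m x) x hx hxs hk'
    obtain ⟨f1, f2⟩ := sh_mem (m x) y hy hys hk
    have h2 := hψ.inj _ e1 ⟨e2, by rw [onCoord_same]; linarith⟩ _ f1
      ⟨f2, by rw [onCoord_same]; linarith⟩ h1
    exact onCoord_injective (i := i) (h := (· + -(4 * (m x : ℝ))))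
      (k := (· + 4 * (m x : ℝ))) (fun t => by ring) h2
  · intro x hx hxs h
    rw [Φ_eq 0 x hx hxs (fun h => absurd rfl h) (by simp; linarith), P_zero]
    exact hψ1 x hx hxs (by linarith)
  · intro Z hZ hgZ x hx hxs hxZ
    have u := m_ub x
    have l := m_lb x
    obtain ⟨e1, e2⟩ := sh_mem (m x) x hx hxs (fun h => by linarith [l h])
    have := hψ3 Z hZ hgZ _ e1 e2 (by rw [onCoord_same]; linarith) (hZ _ _ hxZ)
    simp only [hΦ, hP]
    rw [this, onCoord_onCoord]
    exact onCoord_eq_self (by ring)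

end Furl

section Furl

variable {ι : Type*} [Fintype ι] [DecidableEq ι]

theorem NearEmb.conj_neg {B : Set ι} {i : ι} (hi : i ∉ B) {U : Set (ι → ℝ)}
    {g : (ι → ℝ) → ι → ℝ} {δ : ℝ} (hg : NearEmb (orthant B) U g δ) :
    NearEmb (orthant B) {x | onCoord i (-·) x ∈ U}
      (fun x => onCoord i (-·) (g (onCoord i (-·) x))) δ := by
  have hX : ∀ x ∈ orthant B, onCoord i (-·) x ∈ orthant B := fun x hx =>
    onCoord_mem_orthant hx fun h => absurd h hi
  have hl : ∀ x ∈ orthant B, LocHomeoAt (orthant B) (orthant B) (onCoord i (-·)) x := fun x hx =>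
    locHomeoAt_onCoord (k := (-·)) continuous_neg continuous_neg neg_neg neg_neg hx
      (fun h => absurd h hi) fun h => absurd h hi
  refine ⟨fun x hx hxU => ?_, fun x hx hxU => ?_, fun x hx hxU y hy hyU h => ?_⟩
  · have l := hg.loc _ (hX x hx) hxU
    exact ((hl _ l.1).comp l).comp (hl x hx)
  · have e : x = onCoord i (-·) (onCoord i (-·) x) := by
      rw [onCoord_onCoord]; exact (onCoord_eq_self (neg_neg _)).symm
    have d := hg.near _ (hX x hx) hxU
    conv_lhs => rw [e]
    refine dist_onCoord_le i ?_ ?_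
    · rwa [← e]
    · rw [← e, dist_neg_neg]; exact (dist_le_pi_dist _ _ i).trans d
  · have h1 := onCoord_injective (i := i) (h := (-·)) (k := (-·)) neg_neg h
    exact onCoord_injective (i := i) (h := (-·)) (k := (-·)) neg_neg
      (hg.inj _ (hX x hx) hxU _ (hX y hy) hyU h1)

omit [Fintype ι] in
theorem neg_mem_slab {L R : Set ι} {i : ι} (hL : i ∉ L) (hR : i ∉ R) {a : ℝ} {x : ι → ℝ}
    (hx : x ∈ slab L (insert i R) a) : onCoord i (-·) x ∈ slab (insert i L) R a := by
  constructor
  · rintro l (rfl | hl)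
    · rw [onCoord_same]; exact neg_lt_neg (hx.2 l (mem_insert _ _))
    · rw [onCoord_of_ne (ne_of_mem_of_not_mem hl hL)]; exact hx.1 l hl
  · intro l hl
    rw [onCoord_of_ne (ne_of_mem_of_not_mem hl hR)]; exact hx.2 l (mem_insert_of_mem _ hl)

/-- Removal of both constraints on one coordinate from the domain of a near-identity
embedding. -/
theorem NearEmb.furl_both {B L R : Set ι} {i : ι} (hL : i ∉ L) (hR : i ∉ R) {a δ : ℝ}
    (ha : 11 ≤ a) (hδ : 0 < δ) (hδ' : 3 * δ ≤ 1 / 100) {g : (ι → ℝ) → ι → ℝ}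
    (hg : NearEmb (orthant B) (slab (insert i L) (insert i R) a) g δ) :
    ∃ Φ : (ι → ℝ) → ι → ℝ,
      NearEmb (orthant B) (slab L R (a - 2)) Φ (9 * δ) ∧
      (∀ x ∈ orthant B, x ∈ slab L R (a - 2) → |x i| < 5 → Φ x = g x) ∧
      ∀ Z : Set (ι → ℝ), (∀ h, ∀ x ∈ Z, onCoord i h x ∈ Z) →
        (∀ x ∈ orthant B, x ∈ slab (insert i L) (insert i R) a → x ∈ Z → g x = x) →
        ∀ x ∈ orthant B, x ∈ slab L R (a - 2) → x ∈ Z → Φ x = x := by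
  obtain ⟨f, hf, hf1, hf2⟩ := hg.furl hR (by linarith) hδ (by linarith)
  have hmono : ∀ x, x ∈ slab L R (a - 2) → x ∈ slab L R (a - 1) := fun x hx =>
    slab_of_dist (c := 0) hx (by simp) (by linarith)
  by_cases hi : i ∈ B
  · have hs : ∀ x ∈ orthant B, x ∈ slab L R (a - 2) → x ∈ slab (insert i L) R (a - 1) := by
      refine fun x hx hxs => ⟨?_, (hmono x hxs).2⟩
      rintro l (rfl | hl)
      · linarith [hx l hi]
      · exact (hmono x hxs).1 l hl
    exact ⟨f, hf.mono hs (by linarith), fun x hx hxs h => hf1 x hx (hs x hx hxs) (abs_lt.1 h).2,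
      fun Z hZ hgZ x hx hxs hxZ => hf2 Z hZ hgZ x hx (hs x hx hxs) hxZ⟩
  · have hX : ∀ x ∈ orthant B, onCoord i (-·) x ∈ orthant B := fun x hx =>
      onCoord_mem_orthant hx fun h => absurd h hi
    have hinv : ∀ x, onCoord i (-·) (onCoord i (-·) x) = x := fun x => by
      rw [onCoord_onCoord]; exact onCoord_eq_self (neg_neg _)
    have hf' := (hf.conj_neg hi).mono (V := slab L (insert i R) (a - 1))
      (fun x _ hx => neg_mem_slab hL hR hx) le_rfl
    obtain ⟨k, hk, hk1, hk2⟩ := hf'.furl hR (by linarith) (by linarith) hδ'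
    rw [show a - 1 - 1 = a - 2 by ring, show 3 * (3 * δ) = 9 * δ by ring] at hk
    rw [show a - 1 - 1 = a - 2 by ring] at hk1 hk2
    have hs : ∀ x, x ∈ slab L R (a - 2) → onCoord i (-·) x ∈ slab L R (a - 2) := by
      refine fun x hx => ⟨fun l hl => ?_, fun l hl => ?_⟩
      · rw [onCoord_of_ne (ne_of_mem_of_not_mem hl hL)]; exact hx.1 l hl
      · rw [onCoord_of_ne (ne_of_mem_of_not_mem hl hR)]; exact hx.2 l hl
    refine ⟨fun x => onCoord i (-·) (k (onCoord i (-·) x)),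
      (hk.conj_neg hi).mono (fun x _ hx => hs x hx) le_rfl, fun x hx hxs h => ?_,
      fun Z hZ hgZ x hx hxs hxZ => ?_⟩
    · have h' := abs_lt.1 h
      beta_reduce
      rw [hk1 _ (hX x hx) (hs x hxs) (by rw [onCoord_same]; linarith), hinv, hinv]
      refine hf1 x hx ⟨?_, (hmono x hxs).2⟩ h'.2
      rintro l (rfl | hl)
      · linarith
      · exact (hmono x hxs).1 l hl
    · beta_reduce
      rw [hk2 Z hZ _ _ (hX x hx) (hs x hxs) (hZ _ _ hxZ), hinv]
      intro y hy hys hyZ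
      rw [hf2 Z hZ hgZ _ (hX y hy) (neg_mem_slab hL hR hys) (hZ _ _ hyZ), hinv]

/-- Extension of a near-identity embedding of a box to the whole orthant. -/
theorem NearEmb.furl_all {B : Set ι} (F : Finset ι) : ∀ {δ : ℝ}, 0 < δ →
    9 ^ F.card * δ ≤ 1 / 100 → ∀ {g : (ι → ℝ) → ι → ℝ},
    NearEmb (orthant B) (slab F F (10 + 2 * F.card)) g δ →
    ∃ Φ : (ι → ℝ) → ι → ℝ,
      NearEmb (orthant B) univ Φ (9 ^ F.card * δ) ∧
      (∀ x ∈ orthant B, (∀ l ∈ F, |x l| < 5) → Φ x = g x) ∧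
      ∀ Z : Set (ι → ℝ), (∀ l ∈ F, ∀ h, ∀ x ∈ Z, onCoord l h x ∈ Z) →
        (∀ x ∈ orthant B, x ∈ slab F F (10 + 2 * F.card) → x ∈ Z → g x = x) →
        ∀ x ∈ orthant B, x ∈ Z → Φ x = x := by
  induction F using Finset.induction_on with
  | empty =>
    intro δ hδ hδ' g hg
    refine ⟨g, hg.mono (fun x _ _ => by simp [slab]) (by simp), fun _ _ _ => rfl,
      fun Z _ h x hx hxZ => h x hx (by simp [slab]) hxZ⟩
  | insert i F hi ih =>
    intro δ hδ hδ' g hg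
    rw [Finset.card_insert_of_notMem hi] at hg hδ' ⊢
    have h9 : (1 : ℝ) ≤ 9 ^ F.card := one_le_pow₀ (by norm_num)
    have hδ'' : 9 ^ F.card * (9 * δ) ≤ 1 / 100 := by rw [← mul_assoc, ← pow_succ]; exact hδ'
    have hF : (0 : ℝ) ≤ F.card := Nat.cast_nonneg _
    rw [Finset.coe_insert] at hg ⊢
    obtain ⟨f, hf, hf1, hf2⟩ := hg.furl_both (by simpa using hi) (by simpa using hi)
      (by push_cast; linarith) hδ (by nlinarith)
    have ea : (10 + 2 * ((F.card + 1 : ℕ) : ℝ) - 2) = 10 + 2 * F.card := by push_cast; ring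
    rw [ea] at hf hf1 hf2
    obtain ⟨Φ, hΦ, hΦ1, hΦ2⟩ := ih (by positivity) hδ'' hf
    refine ⟨Φ, ?_, ?_, ?_⟩
    · rwa [← mul_assoc, ← pow_succ] at hΦ
    · intro x hx h
      rw [hΦ1 x hx fun l hl => h l (Finset.mem_insert_of_mem hl)]
      refine hf1 x hx ⟨fun l hl => ?_, fun l hl => ?_⟩ (h i (Finset.mem_insert_self _ _)) <;>
      · have := abs_lt.1 (h l (Finset.mem_insert_of_mem hl))
        linarith
    · intro Z hZ hgZ x hx hxZ
      refine hΦ2 Z (fun l hl => hZ l (Finset.mem_insert_of_mem hl)) ?_ x hx hxZ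
      exact fun y hy hys hyZ => hf2 Z (hZ i (Finset.mem_insert_self _ _)) hgZ y hy hys hyZ

end Furl

/-- `G` is a self-homeomorphism of `X`, with inverse `G'`, which moves points by at most `η`. -/
structure NearHomeo {E : Type*} [PseudoMetricSpace E] (X : Set E) (G G' : E → E) (η : ℝ) :
    Prop where
  maps : MapsTo G X X
  maps' : MapsTo G' X X
  cont : ContinuousOn G X
  cont' : ContinuousOn G' X
  left : ∀ x ∈ X, G' (G x) = x
  right : ∀ x ∈ X, G (G' x) = x
  near : ∀ x ∈ X, dist (G x) x ≤ η

namespace NearHomeo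

variable {E : Type*} [PseudoMetricSpace E] {X : Set E} {G G' H H' : E → E} {η η' : ℝ}

theorem symm (h : NearHomeo X G G' η) : NearHomeo X G' G η where
  maps := h.maps'
  maps' := h.maps
  cont := h.cont'
  cont' := h.cont
  left := h.right
  right := h.left
  near x hx := by
    have := h.near _ (h.maps' hx)
    rwa [h.right x hx, dist_comm] at this

theorem comp (hH : NearHomeo X H H' η') (hG : NearHomeo X G G' η) :
    NearHomeo X (H ∘ G) (G' ∘ H') (η' + η) where
  maps := hH.maps.comp hG.maps
  maps' := hG.maps'.comp hH.maps'
  cont := hH.cont.comp hG.cont hG.maps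
  cont' := hG.cont'.comp hH.cont' hH.maps'
  left x hx := by simp [hH.left _ (hG.maps hx), hG.left x hx]
  right x hx := by simp [hG.right _ (hH.maps' hx), hH.right x hx]
  near x hx := (dist_triangle _ (G x) _).trans
    (add_le_add (hH.near _ (hG.maps hx)) (hG.near x hx))

theorem mono (h : NearHomeo X G G' η) (hη : η ≤ η') : NearHomeo X G G' η' where
  maps := h.maps
  maps' := h.maps'
  cont := h.cont
  cont' := h.cont'
  left := h.left
  right := h.right
  near x hx := (h.near x hx).trans hη

theorem refl (hη : 0 ≤ η) : NearHomeo X (fun x => x) (fun x => x) η where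
  maps _ h := h
  maps' _ h := h
  cont := continuousOn_id
  cont' := continuousOn_id
  left _ _ := rfl
  right _ _ := rfl
  near x _ := by simpa using hη

theorem locHomeoAt (h : NearHomeo X G G' η) {x : E} (hx : x ∈ X) : LocHomeoAt X X G x := by
  have key : ∀ {G : E → E}, ContinuousOn G X → MapsTo G X X → ∀ {x}, x ∈ X →
      Tendsto G (𝓝[X] x) (𝓝[X] (G x)) := fun hc hm x hx =>
    tendsto_nhdsWithin_iff.2 ⟨hc x hx, by filter_upwards [self_mem_nhdsWithin] with y hy using hm hy⟩
  refine LocHomeoAt.of_inverse (h := G') (key h.cont h.maps hx) (h.maps hx) ?_ ?_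
  · have := key h.cont' h.maps' (h.maps hx)
    rwa [h.left x hx] at this
  · filter_upwards [self_mem_nhdsWithin] with y hy using h.right y hy

theorem injOn (h : NearHomeo X G G' η) : InjOn G X := fun x hx y hy e => by
  rw [← h.left x hx, ← h.left y hy, e]

end NearHomeo

theorem NearEmb.exists_nearHomeo {E : Type*} [NormedAddCommGroup E] [NormedSpace ℝ E]
    [ProperSpace E] {X : Set E} {g : E → E} {δ : ℝ} (hg : NearEmb X univ g δ)
    (hXc : Convex ℝ X) (hX : IsClosed X) (hδ : 0 < δ) : ∃ g', NearHomeo X g g' δ := by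
  rcases X.eq_empty_or_nonempty with rfl | hne
  · exact ⟨g, by constructor <;> simp [MapsTo]⟩
  have : Nonempty E := ⟨hne.some⟩
  set g' := Function.invFunOn g X
  have hs : SurjOn g X X := fun y hy => by
    obtain ⟨b, hb, -, e⟩ := hg.exists_preimage hXc hX hδ hy fun _ _ _ => mem_univ _
    exact ⟨b, hb, e⟩
  have hi : InjOn g X := fun x hx y hy h => hg.inj x hx (mem_univ _) y hy (mem_univ _) h
  have hl : LeftInvOn g' g X := hi.leftInvOn_invFunOn
  have hr : RightInvOn g' g X := hs.rightInvOn_invFunOn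
  have hm' : MapsTo g' X X := fun y hy => Function.invFunOn_mem (hs hy)
  refine ⟨g', fun x hx => (hg.loc x hx (mem_univ _)).1, hm',
    fun x hx => (hg.loc x hx (mem_univ _)).tendsto.mono_right nhdsWithin_le_nhds, fun y hy => ?_,
    hl, hr, fun x hx => hg.near x hx (mem_univ _)⟩
  have l := (hg.loc _ (hm' hy) (mem_univ _)).of_leftInverse (h := g') (hm' hy)
    (by filter_upwards [self_mem_nhdsWithin] with z hz using hl hz)
  rw [hr hy] at l
  exact l.tendsto.mono_right nhdsWithin_le_nhds

section Squeeze

variable {E : Type*} [NormedAddCommGroup E] [NormedSpace ℝ E]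

/-- A radial homeomorphism onto the open ball of radius `2`. -/
noncomputable def shrink (x : E) : E := (2 / max 1 ‖x‖ - 1 / (max 1 ‖x‖) ^ 2) • x

/-- The inverse of `shrink`. -/
noncomputable def unshrink (y : E) : E := (max 1 ‖y‖ * (2 - max 1 ‖y‖))⁻¹ • y

theorem shrink_of_le {x : E} (h : ‖x‖ ≤ 1) : shrink x = x := by
  rw [shrink, max_eq_left h]; norm_num

theorem unshrink_of_le {x : E} (h : ‖x‖ ≤ 1) : unshrink x = x := by
  rw [unshrink, max_eq_left h]; norm_num

omit [NormedSpace ℝ E] in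
theorem shrink_coeff_pos (x : E) : 0 < 2 / max 1 ‖x‖ - 1 / (max 1 ‖x‖) ^ 2 := by
  have h : 1 ≤ max 1 ‖x‖ := le_max_left _ _
  generalize max 1 ‖x‖ = r at h
  have : 2 / r - 1 / r ^ 2 = (2 * r - 1) / r ^ 2 := by field_simp
  rw [this]
  apply div_pos <;> nlinarith

theorem norm_shrink {x : E} (h : 1 < ‖x‖) : ‖shrink x‖ = 2 - 1 / ‖x‖ := by
  rw [shrink, norm_smul, Real.norm_of_nonneg (shrink_coeff_pos x).le, max_eq_right h.le]
  field_simp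

theorem norm_shrink_lt (x : E) : ‖shrink x‖ < 2 := by
  rcases le_or_gt ‖x‖ 1 with h | h
  · rw [shrink_of_le h]; linarith
  · rw [norm_shrink h]
    have : 0 < 1 / ‖x‖ := by positivity
    linarith

theorem unshrink_shrink (x : E) : unshrink (shrink x) = x := by
  rcases le_or_gt ‖x‖ 1 with h | h
  · rw [shrink_of_le h, unshrink_of_le h]
  · have h1 : 1 / ‖x‖ < 1 := by rw [div_lt_one (by linarith)]; exact h
    rw [unshrink, norm_shrink h, max_eq_right (by linarith), shrink, max_eq_right h.le, smul_smul]
    have h2 : 2 * ‖x‖ - 1 ≠ 0 := by linarith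
    have : ((2 - 1 / ‖x‖) * (2 - (2 - 1 / ‖x‖)))⁻¹ * (2 / ‖x‖ - 1 / ‖x‖ ^ 2) = 1 := by
      field_simp
      ring_nf
    rw [this, one_smul]

omit [NormedSpace ℝ E] in
theorem one_le_unshrink_coeff {y : E} (h : ‖y‖ < 2) :
    1 ≤ (max 1 ‖y‖ * (2 - max 1 ‖y‖))⁻¹ := by
  have h1 : 1 ≤ max 1 ‖y‖ := le_max_left _ _
  have h2 : max 1 ‖y‖ < 2 := max_lt (by norm_num) h
  generalize max 1 ‖y‖ = s at *
  rw [one_le_inv₀ (by nlinarith)]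
  nlinarith [sq_nonneg (s - 1)]

theorem norm_unshrink {y : E} (h1 : 1 < ‖y‖) (h : ‖y‖ < 2) : ‖unshrink y‖ = (2 - ‖y‖)⁻¹ := by
  rw [unshrink, norm_smul, Real.norm_of_nonneg (by linarith [one_le_unshrink_coeff h]),
    max_eq_right h1.le, mul_inv]
  have : 2 - ‖y‖ ≠ 0 := by linarith
  field_simp

theorem max_norm_unshrink {y : E} (h : ‖y‖ < 2) :
    (max 1 ‖unshrink y‖)⁻¹ = 2 - max 1 ‖y‖ := by
  rcases le_or_gt ‖y‖ 1 with h1 | h1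
  · rw [unshrink_of_le h1, max_eq_left h1]; norm_num
  · rw [norm_unshrink h1 h, max_eq_right, inv_inv, max_eq_right h1.le]
    rw [one_le_inv₀] <;> linarith

theorem shrink_unshrink {y : E} (h : ‖y‖ < 2) : shrink (unshrink y) = y := by
  have e := max_norm_unshrink h
  have h1 : 1 ≤ max 1 ‖y‖ := le_max_left _ _
  have h2 : max 1 ‖y‖ < 2 := max_lt (by norm_num) h
  rw [shrink, div_eq_mul_inv, one_div, ← inv_pow, e, unshrink, smul_smul]
  generalize max 1 ‖y‖ = s at *
  have : (2 * (2 - s) - (2 - s) ^ 2) * (s * (2 - s))⁻¹ = 1 := by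
    have : 2 - s ≠ 0 := by linarith
    have : s ≠ 0 := by linarith
    field_simp
    ring
  rw [this, one_smul]

theorem dist_shrink_le (x x' : E) : dist (shrink x') (shrink x) ≤ 4 * dist x' x * (max 1 ‖x‖)⁻¹ := by
  have hr : 1 ≤ max 1 ‖x‖ := le_max_left _ _
  have hr' : 1 ≤ max 1 ‖x'‖ := le_max_left _ _
  have hx' : ‖x'‖ ≤ max 1 ‖x'‖ := le_max_right _ _
  have hd : |max 1 ‖x'‖ - max 1 ‖x‖| ≤ ‖x' - x‖ := by
      rw [max_comm 1, max_comm 1]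
      exact (abs_max_sub_max_le_abs _ _ _).trans (abs_norm_sub_norm_le _ _)
  have e : shrink x' - shrink x = (2 / max 1 ‖x‖ - 1 / (max 1 ‖x‖) ^ 2) • (x' - x) +
      ((2 / max 1 ‖x'‖ - 1 / (max 1 ‖x'‖) ^ 2) - (2 / max 1 ‖x‖ - 1 / (max 1 ‖x‖) ^ 2)) • x' := by
    simp only [shrink, smul_sub, sub_smul]; abel
  have hp := shrink_coeff_pos x
  rw [dist_eq_norm, dist_eq_norm, e]
  generalize max 1 ‖x‖ = r at *
  generalize max 1 ‖x'‖ = r' at *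
  have hrr : (2 / r' - 1 / r' ^ 2) - (2 / r - 1 / r ^ 2) =
      (r - r') / (r * r') * (2 - 1 / r - 1 / r') := by field_simp; ring
  have i1 : 0 < 1 / r := by positivity
  have i2 : 1 / r ≤ 1 := by rw [div_le_one] <;> linarith
  have i3 : 0 < 1 / r' := by positivity
  have i4 : 1 / r' ≤ 1 := by rw [div_le_one] <;> linarith
  calc _ ≤ ‖(2 / r - 1 / r ^ 2) • (x' - x)‖ + ‖((2 / r' - 1 / r' ^ 2) - (2 / r - 1 / r ^ 2)) • x'‖ :=
        norm_add_le _ _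
    _ ≤ (2 / r) * ‖x' - x‖ + (‖x' - x‖ / (r * r') * 2) * r' := by
        rw [norm_smul, norm_smul, Real.norm_of_nonneg hp.le]
        have : 0 ≤ 1 / r ^ 2 := by positivity
        gcongr
        · linarith
        · rw [hrr, Real.norm_eq_abs, abs_mul, abs_div, abs_of_pos (show 0 < r * r' by positivity),
            abs_sub_comm r]
          gcongr
          rw [abs_le]; constructor <;> linarith
    _ = _ := by field_simp; ring

theorem continuous_shrink : Continuous (shrink : E → E) := by
  refine Metric.continuous_iff.2 fun x ε hε => ⟨ε / 4, by positivity, fun x' h => ?_⟩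
  have h1 := dist_shrink_le x x'
  have h2 : (max 1 ‖x‖)⁻¹ ≤ 1 := inv_le_one_of_one_le₀ (le_max_left _ _)
  have h3 : 0 ≤ 4 * dist x' x := by positivity
  nlinarith

theorem continuousOn_unshrink : ContinuousOn (unshrink : E → E) {y | ‖y‖ < 2} := by
  unfold unshrink
  refine ContinuousOn.smul (ContinuousOn.inv₀ (by fun_prop) fun y hy => ?_) continuousOn_id
  have := one_le_unshrink_coeff hy
  intro h
  rw [h] at this
  norm_num at this

/-- Conjugation by `shrink`, extended by the identity. -/
noncomputable def squeeze (Φ : E → E) (y : E) : E :=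
  open Classical in if ‖y‖ < 2 then shrink (Φ (unshrink y)) else y

theorem squeeze_of_lt {Φ : E → E} {y : E} (h : ‖y‖ < 2) :
    squeeze Φ y = shrink (Φ (unshrink y)) := if_pos h

theorem squeeze_of_ge {Φ : E → E} {y : E} (h : 2 ≤ ‖y‖) : squeeze Φ y = y := if_neg h.not_gt

theorem squeeze_of_le {Φ : E → E} {y : E} (h : ‖y‖ ≤ 1) (h' : ‖Φ y‖ ≤ 1) : squeeze Φ y = Φ y := by
  rw [squeeze_of_lt (by linarith), unshrink_of_le h, shrink_of_le h']

theorem squeeze_eq_self {Φ : E → E} {y : E} (h : ∀ c : ℝ, 1 ≤ c → Φ (c • y) = c • y) :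
    squeeze Φ y = y := by
  rcases lt_or_ge ‖y‖ 2 with h2 | h2
  · rw [squeeze_of_lt h2, unshrink, h _ (one_le_unshrink_coeff h2)]
    exact shrink_unshrink h2
  · exact squeeze_of_ge h2

theorem NearHomeo.squeeze {X : Set E} (hX : ∀ c : ℝ, 0 < c → ∀ x ∈ X, c • x ∈ X)
    {Φ Φ' : E → E} {δ : ℝ} (hδ : 0 ≤ δ) (h : NearHomeo X Φ Φ' δ) :
    NearHomeo X (squeeze Φ) (squeeze Φ') (4 * δ) := by
  have hus : ∀ y ∈ X, ‖y‖ < 2 → unshrink y ∈ X := fun y hy hy2 =>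
    hX _ (by linarith [one_le_unshrink_coeff hy2]) y hy
  have maps : ∀ {Φ Φ' : E → E}, NearHomeo X Φ Φ' δ →
      MapsTo (TopologicalStability.squeeze Φ) X X := by
    intro Φ Φ' h y hy
    rcases lt_or_ge ‖y‖ 2 with h2 | h2
    · rw [squeeze_of_lt h2]
      exact hX _ (shrink_coeff_pos _) _ (h.maps (hus y hy h2))
    · rwa [squeeze_of_ge h2]
  have left : ∀ {Φ Φ' : E → E}, NearHomeo X Φ Φ' δ →
      ∀ y ∈ X, TopologicalStability.squeeze Φ' (TopologicalStability.squeeze Φ y) = y := by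
    intro Φ Φ' h y hy
    rcases lt_or_ge ‖y‖ 2 with h2 | h2
    · rw [squeeze_of_lt h2, squeeze_of_lt (norm_shrink_lt _), unshrink_shrink,
        h.left _ (hus y hy h2), shrink_unshrink h2]
    · rw [squeeze_of_ge h2, squeeze_of_ge h2]
  have near : ∀ {Φ Φ' : E → E}, NearHomeo X Φ Φ' δ → ∀ y ∈ X,
      dist (TopologicalStability.squeeze Φ y) y ≤ 4 * δ * max 0 (2 - max 1 ‖y‖) := by
    intro Φ Φ' h y hy
    rcases lt_or_ge ‖y‖ 2 with h2 | h2
    · rw [squeeze_of_lt h2]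
      conv_lhs => rw [← shrink_unshrink h2, unshrink_shrink]
      refine (dist_shrink_le _ _).trans ?_
      rw [max_norm_unshrink h2]
      have h3 : max 1 ‖y‖ < 2 := max_lt (by norm_num) h2
      have := h.near _ (hus y hy h2)
      exact mul_le_mul (by linarith) (le_max_right _ _) (by linarith) (by positivity)
    · rw [squeeze_of_ge h2, dist_self]; positivity
  have cont : ∀ {Φ Φ' : E → E}, NearHomeo X Φ Φ' δ →
      ContinuousOn (TopologicalStability.squeeze Φ) X := by
    intro Φ Φ' h y hy
    rcases lt_or_ge ‖y‖ 2 with h2 | h2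
    · have ho : IsOpen {y : E | ‖y‖ < 2} := isOpen_lt continuous_norm continuous_const
      have h3 : ContinuousOn (fun y => shrink (Φ (unshrink y))) (X ∩ {y : E | ‖y‖ < 2}) :=
        continuous_shrink.comp_continuousOn (h.cont.comp
          (continuousOn_unshrink.mono inter_subset_right) fun y hy => hus y hy.1 hy.2)
      have h4 := (h3 y ⟨hy, h2⟩).mono_of_mem_nhdsWithin
        (inter_mem self_mem_nhdsWithin (mem_nhdsWithin_of_mem_nhds (ho.mem_nhds h2)))
      refine h4.congr_of_eventuallyEq ?_ (squeeze_of_lt h2)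
      filter_upwards [mem_nhdsWithin_of_mem_nhds (ho.mem_nhds h2)] with z hz
        using squeeze_of_lt hz
    · rw [ContinuousWithinAt, squeeze_of_ge h2, tendsto_iff_dist_tendsto_zero]
      have hc : Tendsto (fun z : E => 4 * δ * max 0 (2 - max 1 ‖z‖) + dist z y) (𝓝[X] y) (𝓝 0) := by
        have : Continuous fun z : E => 4 * δ * max 0 (2 - max 1 ‖z‖) + dist z y := by fun_prop
        have := this.tendsto y
        rw [dist_self, max_eq_left (by linarith [le_max_right 1 ‖y‖])] at this
        simpa using this.mono_left nhdsWithin_le_nhds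
      refine squeeze_zero' (Eventually.of_forall fun _ => dist_nonneg) ?_ hc
      filter_upwards [self_mem_nhdsWithin] with z hz
      exact (dist_triangle _ z _).trans (by linarith [near h z hz])
  refine ⟨maps h, maps h.symm, cont h, cont h.symm, left h, left h.symm, fun y hy => ?_⟩
  refine (near h y hy).trans (mul_le_of_le_one_right (by positivity) (max_le zero_le_one ?_))
  linarith [le_max_left 1 ‖y‖]

end Squeeze

section Handle

variable {ι : Type*} [Fintype ι] [DecidableEq ι]

/-- The half-widths of the domain on which a handle is straightened. -/
noncomputable def handleWidth (F : Finset ι) (e : ℝ) (l : ι) : ℝ :=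
  if l ∈ F then 10 + 2 * F.card else 1 / 2 + e

omit [Fintype ι] in
theorem handleWidth_of_mem {F : Finset ι} {e : ℝ} {l : ι} (hl : l ∈ F) :
    handleWidth F e l = 10 + 2 * F.card := if_pos hl

omit [Fintype ι] in
theorem handleWidth_of_notMem {F : Finset ι} {e : ℝ} {l : ι} (hl : l ∉ F) :
    handleWidth F e l = 1 / 2 + e := if_neg hl

omit [Fintype ι] [DecidableEq ι] in
theorem smul_orthant {B : Set ι} (c : ℝ) (hc : 0 < c) (x : ι → ℝ) (hx : x ∈ orthant B) :
    c • x ∈ orthant B := fun i hi => mul_nonneg hc.le (hx i hi)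

/-- Straightening of a handle in normalized position. -/
theorem NearEmb.exists_handle {B : Set ι} {F : Finset ι} {δ e : ℝ} (hδ : 0 < δ) (hδe : δ ≤ e)
    (he : e ≤ 1 / 4) (hs : 9 ^ F.card * δ ≤ 1 / 100) {g : (ι → ℝ) → ι → ℝ}
    (hg : NearEmb (orthant B) {x | ∀ l, |x l| < handleWidth F e l} g δ)
    (hid : ∀ x ∈ orthant B, (∀ l, |x l| < handleWidth F e l) → (∃ l ∉ F, 1 / 2 ≤ |x l|) →
      g x = x) :
    ∃ G G', NearHomeo (orthant B) G G' (4 * (9 ^ F.card * δ)) ∧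
      (∀ x ∈ orthant B, (2 ≤ ‖x‖ ∨ ∃ l ∉ F, 1 / 2 ≤ |x l|) → G x = x) ∧
      ∀ x ∈ orthant B, (∀ l ∉ F, |x l| < 1 / 2 + e) → (∀ l ∈ F, |x l| < 1 / 2) → G x = g x := by
  classical
  set X := orthant B with hX
  set O : Set (ι → ℝ) := {x | ∀ l, |x l| < handleWidth F e l} with hO
  have hF : (0 : ℝ) ≤ F.card := Nat.cast_nonneg _
  have hOo : IsOpen O := by
    have : O = ⋂ l, {x | |x l| < handleWidth F e l} := by ext; simp [hO]
    rw [this]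
    exact isOpen_iInter_of_finite fun l => isOpen_lt (continuous_apply l).abs continuous_const
  set f : (ι → ℝ) → ι → ℝ := fun x => if x ∈ O then g x else x with hf
  have fin : ∀ x, x ∈ O → f x = g x := fun x h => if_pos h
  have fout : ∀ x ∈ X, (∃ l ∉ F, 1 / 2 ≤ |x l|) → f x = x := by
    intro x hx h
    simp only [hf]
    split_ifs with h'
    · exact hid x hx h' h
    · rfl
  have dich : ∀ x, x ∈ slab F F (10 + 2 * F.card) → x ∉ O → ∃ l ∉ F, 1 / 2 + e ≤ |x l| := by
    intro x hx h
    simp only [hO, mem_ofPred_eq, not_forall, not_lt] at h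
    obtain ⟨l, hl⟩ := h
    by_cases hlF : l ∈ F
    · rw [handleWidth_of_mem hlF] at hl
      have := abs_lt.2 ⟨hx.1 l hlF, hx.2 l hlF⟩
      linarith
    · exact ⟨l, hlF, by rwa [handleWidth_of_notMem hlF] at hl⟩
  have cross : ∀ x ∈ X, x ∈ O → ∀ y ∈ X, y ∈ slab F F (10 + 2 * F.card) → y ∉ O →
      f x = f y → x = y := by
    intro x hx hxO y hy hys hyO h
    obtain ⟨l, hl, hl'⟩ := dich y hys hyO
    rw [fout y hy ⟨l, hl, by linarith⟩, fin x hxO] at h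
    have h1 := abs_sub_le_of_dist_le (hg.near x hx hxO) l
    rw [h] at h1
    have h2 := abs_sub_abs_le_abs_sub (y l) (x l)
    rw [← h, hid x hx hxO ⟨l, hl, by linarith⟩]
  have hfe : NearEmb X (slab F F (10 + 2 * F.card)) f δ := by
    refine ⟨fun x hx hxs => ?_, fun x hx hxs => ?_, fun x hx hxs y hy hys h => ?_⟩
    · by_cases h : x ∈ O
      · refine (hg.loc x hx h).congr hx ?_
        filter_upwards [mem_nhdsWithin_of_mem_nhds (hOo.mem_nhds h)] with y hy using fin y hy
      · obtain ⟨l, hl, hl'⟩ := dich x hxs h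
        refine (LocHomeoAt.id' hx).congr hx ?_
        have : ∀ᶠ y : ι → ℝ in 𝓝 x, 1 / 2 < |y l| :=
          (continuous_apply l).abs.continuousAt.eventually (lt_mem_nhds (by linarith))
        filter_upwards [self_mem_nhdsWithin, mem_nhdsWithin_of_mem_nhds this] with y hy hy'
        exact fout y hy ⟨l, hl, hy'.le⟩
    · by_cases h : x ∈ O
      · rw [fin x h]; exact hg.near x hx h
      · simp only [hf, if_neg h, dist_self]; exact hδ.le
    · by_cases hxO : x ∈ O <;> by_cases hyO : y ∈ O
      · rw [fin x hxO, fin y hyO] at h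
        exact hg.inj x hx hxO y hy hyO h
      · exact cross x hx hxO y hy hys hyO h
      · exact (cross y hy hyO x hx hxs hxO h.symm).symm
      · simpa [hf, hxO, hyO] using h
  obtain ⟨Φ, hΦ, hΦ1, hΦ2⟩ := NearEmb.furl_all F hδ hs hfe
  obtain ⟨Φ', hΦ'⟩ := hΦ.exists_nearHomeo (convex_orthant B) (isClosed_orthant B) (by positivity)
  refine ⟨squeeze Φ, squeeze Φ', hΦ'.squeeze smul_orthant
    (by positivity), ?_, ?_⟩
  · rintro x hx (h | ⟨l, hl, h⟩)
    · exact squeeze_of_ge h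
    · refine squeeze_eq_self fun c hc => ?_
      refine hΦ2 {x | 1 / 2 ≤ |x l|} ?_ ?_ _ (smul_orthant c (by linarith) x hx) ?_
      · intro i hi h x hx
        rw [mem_ofPred_eq, onCoord_of_ne (ne_of_mem_of_not_mem hi hl).symm]; exact hx
      · exact fun y hy _ hyl => fout y hy ⟨l, hl, hyl⟩
      · rw [mem_ofPred_eq, Pi.smul_apply, smul_eq_mul, abs_mul, abs_of_pos (by linarith)]
        nlinarith [abs_nonneg (x l)]
  · intro x hx h1 h2
    have hxO : x ∈ O := fun l => by
      by_cases hl : l ∈ F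
      · rw [handleWidth_of_mem hl]; linarith [h2 l hl]
      · rw [handleWidth_of_notMem hl]; exact h1 l hl
    have e1 : Φ x = g x := by
      rw [hΦ1 x hx fun l hl => by linarith [h2 l hl], fin x hxO]
    have hx2 : ‖x‖ ≤ 3 / 4 := (pi_norm_le_iff_of_nonneg (by norm_num)).2 fun l => by
      rw [Real.norm_eq_abs]
      by_cases hl : l ∈ F
      · linarith [h2 l hl]
      · linarith [h1 l hl]
    rw [squeeze_of_le (by linarith) _, e1]
    rw [e1]
    have h3 := hg.near x hx hxO
    rw [dist_eq_norm] at h3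
    have h4 := norm_le_norm_add_norm_sub' (g x) x
    linarith

/-- The diagonal affine map with centre `m` and scales `s`. -/
def diag (m s : ι → ℝ) (x : ι → ℝ) : ι → ℝ := fun l => m l + s l * x l

/-- The inverse of `diag`. -/
noncomputable def undiag (m s : ι → ℝ) (y : ι → ℝ) : ι → ℝ := fun l => (y l - m l) / s l

omit [Fintype ι] [DecidableEq ι] in
theorem diag_undiag {m s : ι → ℝ} (hs : ∀ l, 0 < s l) (y : ι → ℝ) :
    diag m s (undiag m s y) = y := by
  ext l
  have := (hs l).ne'
  simp only [diag, undiag]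
  field_simp
  ring

omit [Fintype ι] [DecidableEq ι] in
theorem undiag_diag {m s : ι → ℝ} (hs : ∀ l, 0 < s l) (x : ι → ℝ) :
    undiag m s (diag m s x) = x := by
  ext l
  have := (hs l).ne'
  simp only [diag, undiag]
  field_simp
  ring_nf

omit [Fintype ι] [DecidableEq ι] in
theorem continuous_diag (m s : ι → ℝ) : Continuous (diag m s) := by unfold diag; fun_prop

omit [Fintype ι] [DecidableEq ι] in
theorem continuous_undiag (m s : ι → ℝ) : Continuous (undiag m s) := by unfold undiag; fun_prop

omit [DecidableEq ι] in
theorem dist_undiag_le {m s : ι → ℝ} {σ : ℝ} (hσ : 0 < σ) (hs : ∀ l, σ ≤ s l) (x y : ι → ℝ) :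
    dist (undiag m s x) (undiag m s y) ≤ dist x y / σ := by
  refine (dist_pi_le_iff (by positivity)).2 fun l => ?_
  have := hs l
  simp only [undiag]
  rw [Real.dist_eq, ← sub_div, sub_sub_sub_cancel_right, abs_div, abs_of_pos (hσ.trans_le this)]
  have := dist_le_pi_dist x y l
  rw [Real.dist_eq] at this
  gcongr

omit [DecidableEq ι] in
theorem dist_diag_le {m s : ι → ℝ} (hs0 : ∀ l, 0 < s l) (hs : ∀ l, s l ≤ 1) (x y : ι → ℝ) :
    dist (diag m s x) (diag m s y) ≤ dist x y := by
  refine (dist_pi_le_iff dist_nonneg).2 fun l => ?_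
  simp only [diag]
  rw [Real.dist_eq, add_sub_add_left_eq_sub, ← mul_sub, abs_mul, abs_of_pos (hs0 l)]
  exact (mul_le_of_le_one_left (abs_nonneg _) (hs l)).trans (dist_le_pi_dist x y l)

/-- Straightening of a handle. -/
theorem NearEmb.exists_handle_diag {B : Set ι} {F : Finset ι} {m s : ι → ℝ} {δ e σ : ℝ}
    (hδ : 0 < δ) (hσ : 0 < σ) (hsσ : ∀ l, σ ≤ s l) (hs1 : ∀ l, s l ≤ 1) (hδe : δ / σ ≤ e)
    (he : e ≤ 1 / 4) (hs : 9 ^ F.card * (δ / σ) ≤ 1 / 100)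
    (hm : ∀ l ∈ B, m l ≠ 0 → δ + s l * handleWidth F e l < m l) {g : (ι → ℝ) → ι → ℝ}
    (hg : NearEmb (orthant B) {y | ∀ l, |undiag m s y l| < handleWidth F e l} g δ)
    (hid : ∀ y ∈ orthant B, (∀ l, |undiag m s y l| < handleWidth F e l) →
      (∃ l ∉ F, 1 / 2 ≤ |undiag m s y l|) → g y = y) :
    ∃ G G', NearHomeo (orthant B) G G' (4 * (9 ^ F.card * (δ / σ))) ∧
      (∀ y ∈ orthant B, ((∃ l ∈ F, 2 ≤ |undiag m s y l|) ∨ ∃ l ∉ F, 1 / 2 ≤ |undiag m s y l|) →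
        G y = y) ∧
      ∀ y ∈ orthant B, (∀ l ∉ F, |undiag m s y l| < 1 / 2 + e) →
        (∀ l ∈ F, |undiag m s y l| < 1 / 2) → G y = g y := by
  have hs0 : ∀ l, 0 < s l := fun l => hσ.trans_le (hsσ l)
  have hF : (0 : ℝ) ≤ F.card := Nat.cast_nonneg _
  have he0 : 0 < e := lt_of_lt_of_le (by positivity) hδe
  set B' : Set ι := {l | l ∈ B ∧ m l = 0} with hB'
  set P : Set (ι → ℝ) := {x | ∀ l ∈ B, m l ≠ 0 → -m l < s l * x l} with hP
  have hPo : IsOpen P := by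
    have : P = ⋂ l, {x | l ∈ B → m l ≠ 0 → -m l < s l * x l} := by ext; simp [hP]
    rw [this]
    refine isOpen_iInter_of_finite fun l => ?_
    by_cases h : l ∈ B ∧ m l ≠ 0
    · simp only [h.1, h.2, ne_eq, not_false_eq_true, true_imp_iff]
      exact isOpen_lt continuous_const (continuous_const.mul (continuous_apply l))
    · convert isOpen_univ
      ext x
      simp only [mem_ofPred_eq, mem_univ, iff_true]
      exact fun h1 h2 => absurd ⟨h1, h2⟩ h
  have toB : ∀ x ∈ orthant B', x ∈ P → diag m s x ∈ orthant B := by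
    intro x hx hxP l hl
    by_cases h : m l = 0
    · simp only [diag, h, zero_add]; exact mul_nonneg (hs0 l).le (hx l ⟨hl, h⟩)
    · have := hxP l hl h; simp only [diag]; linarith
  have toB' : ∀ y ∈ orthant B, undiag m s y ∈ orthant B' := by
    rintro y hy l ⟨hl, h⟩
    simp only [undiag, h, sub_zero]; exact div_nonneg (hy l hl) (hs0 l).le
  have lA : ∀ x ∈ orthant B', x ∈ P → LocHomeoAt (orthant B') (orthant B) (diag m s) x := by
    intro x hx hxP
    refine LocHomeoAt.of_inverse (h := undiag m s) ?_ (toB x hx hxP) ?_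
      (Eventually.of_forall fun y => diag_undiag hs0 y)
    · refine tendsto_nhdsWithin_iff.2 ⟨(continuous_diag m s).continuousAt.tendsto.mono_left
        nhdsWithin_le_nhds, ?_⟩
      filter_upwards [self_mem_nhdsWithin, mem_nhdsWithin_of_mem_nhds (hPo.mem_nhds hxP)]
        with y hy hyP using toB y hy hyP
    · refine tendsto_nhdsWithin_iff.2 ⟨?_, ?_⟩
      · have := (continuous_undiag m s).tendsto (diag m s x)
        rw [undiag_diag hs0] at this
        exact this.mono_left nhdsWithin_le_nhds
      · filter_upwards [self_mem_nhdsWithin] with y hy using toB' y hy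
  have lA' : ∀ y ∈ orthant B, undiag m s y ∈ P →
      LocHomeoAt (orthant B) (orthant B') (undiag m s) y := by
    intro y hy hyP
    have := (lA _ (toB' y hy) hyP).of_leftInverse (h := undiag m s) (toB' y hy)
      (Eventually.of_forall fun y => undiag_diag hs0 y)
    rwa [diag_undiag hs0] at this
  have hOP : ∀ x : ι → ℝ, (∀ l, |x l| < handleWidth F e l) → ∀ l ∈ B, m l ≠ 0 →
      δ < m l + s l * x l := by
    intro x hx l hl h
    have h1 := hm l hl h
    have h2 := mul_lt_mul_of_pos_left (abs_lt.1 (hx l)).1 (hs0 l)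
    linarith
  have hOP' : ∀ x : ι → ℝ, (∀ l, |x l| < handleWidth F e l) → x ∈ P := by
    intro x hx l hl h
    linarith [hOP x hx l hl h]
  set f : (ι → ℝ) → ι → ℝ := fun x => undiag m s (g (diag m s x)) with hf
  have hfe : NearEmb (orthant B') {x | ∀ l, |x l| < handleWidth F e l} f (δ / σ) := by
    have hmem : ∀ x, (∀ l, |x l| < handleWidth F e l) →
        diag m s x ∈ {y | ∀ l, |undiag m s y l| < handleWidth F e l} := fun x hx => by
      rwa [mem_ofPred_eq, undiag_diag hs0]
    refine ⟨fun x hx hxO => ?_, fun x hx hxO => ?_, fun x hx hxO y hy hyO h => ?_⟩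
    · have hA := toB x hx (hOP' x hxO)
      have l2 := hg.loc _ hA (hmem x hxO)
      have hn := hg.near _ hA (hmem x hxO)
      refine ((lA' _ l2.1 ?_).comp l2).comp (lA x hx (hOP' x hxO))
      intro l hl h
      have h1 := hOP x hxO l hl h
      have h2 := (abs_le.1 (abs_sub_le_of_dist_le hn l)).1
      have h3 : s l * undiag m s (g (diag m s x)) l = g (diag m s x) l - m l := by
        simp only [undiag]; have := (hs0 l).ne'; field_simp
      rw [h3]
      have h4 : diag m s x l = m l + s l * x l := rfl
      linarith
    · have hA := toB x hx (hOP' x hxO)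
      have := dist_undiag_le (m := m) hσ hsσ (g (diag m s x)) (diag m s x)
      rw [undiag_diag hs0] at this
      exact this.trans (by have := hg.near _ hA (hmem x hxO); gcongr)
    · have h1 := congrArg (diag m s) h
      simp only [hf, diag_undiag hs0] at h1
      have h2 := hg.inj _ (toB x hx (hOP' x hxO)) (hmem x hxO) _ (toB y hy (hOP' y hyO))
        (hmem y hyO) h1
      rw [← undiag_diag (m := m) hs0 x, h2, undiag_diag hs0]
  obtain ⟨H, H', hH, hH1, hH2⟩ := hfe.exists_handle (by positivity) hδe he hs (by
    intro x hx hxO hx'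
    simp only [hf]
    rw [hid _ (toB x hx (hOP' x hxO)) (by rwa [undiag_diag hs0]) (by rwa [undiag_diag hs0]),
      undiag_diag hs0])
  have hQ : ∀ x ∈ orthant B', x ∉ P → (2 ≤ ‖x‖ ∨ ∃ l ∉ F, 1 / 2 ≤ |x l|) := by
    intro x hx hxP
    by_contra! h
    refine hxP (hOP' x fun l => ?_)
    by_cases hl : l ∈ F
    · rw [handleWidth_of_mem hl]
      have := norm_le_pi_norm x l
      rw [Real.norm_eq_abs] at this
      linarith
    · rw [handleWidth_of_notMem hl]
      linarith [h.2 l hl]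
  have presP : ∀ {H H' : (ι → ℝ) → ι → ℝ} {c : ℝ}, NearHomeo (orthant B') H H' c →
      (∀ x ∈ orthant B', (2 ≤ ‖x‖ ∨ ∃ l ∉ F, 1 / 2 ≤ |x l|) → H x = x) →
      ∀ x ∈ orthant B', x ∈ P → H x ∈ P := by
    intro H H' c hH hid x hx hxP
    by_contra h
    have := hid _ (hH.maps hx) (hQ _ (hH.maps hx) h)
    rw [hH.injOn (hH.maps hx) hx this] at h
    exact h hxP
  have hH1' : ∀ x ∈ orthant B', (2 ≤ ‖x‖ ∨ ∃ l ∉ F, 1 / 2 ≤ |x l|) → H' x = x := by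
    intro x hx h
    conv_lhs => rw [← hH1 x hx h]
    exact hH.left x hx
  have maps : ∀ {H H' : (ι → ℝ) → ι → ℝ} {c : ℝ}, NearHomeo (orthant B') H H' c →
      (∀ x ∈ orthant B', (2 ≤ ‖x‖ ∨ ∃ l ∉ F, 1 / 2 ≤ |x l|) → H x = x) →
      MapsTo (fun y => diag m s (H (undiag m s y))) (orthant B) (orthant B) := by
    intro H H' c hH hid y hy
    have h1 := toB' y hy
    by_cases h : undiag m s y ∈ P
    · exact toB _ (hH.maps h1) (presP hH hid _ h1 h)
    · beta_reduce
      rwa [hid _ h1 (hQ _ h1 h), diag_undiag hs0]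
  have cont : ∀ {H H' : (ι → ℝ) → ι → ℝ} {c : ℝ}, NearHomeo (orthant B') H H' c →
      ContinuousOn (fun y => diag m s (H (undiag m s y))) (orthant B) := fun hH =>
    (continuous_diag m s).comp_continuousOn
      (hH.cont.comp (continuous_undiag m s).continuousOn toB')
  have left : ∀ {H H' : (ι → ℝ) → ι → ℝ} {c : ℝ}, NearHomeo (orthant B') H H' c →
      ∀ y ∈ orthant B, diag m s (H' (undiag m s (diag m s (H (undiag m s y))))) = y := by
    intro H H' c hH y hy
    rw [undiag_diag hs0, hH.left _ (toB' y hy), diag_undiag hs0]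
  refine ⟨fun y => diag m s (H (undiag m s y)), fun y => diag m s (H' (undiag m s y)),
    ⟨maps hH hH1, maps hH.symm hH1', cont hH, cont hH.symm, left hH, left hH.symm,
      fun y hy => ?_⟩, fun y hy h => ?_, fun y hy h1 h2 => ?_⟩
  · conv_lhs => rw [← diag_undiag (m := m) hs0 y, undiag_diag hs0]
    exact (dist_diag_le hs0 hs1 _ _).trans (hH.near _ (toB' y hy))
  · beta_reduce
    rw [hH1 _ (toB' y hy) (h.imp_left ?_), diag_undiag hs0]
    rintro ⟨l, -, hl⟩
    exact hl.trans (norm_le_pi_norm (undiag m s y) l)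
  · beta_reduce
    rw [hH2 _ (toB' y hy) h1 h2]
    simp only [hf, diag_undiag hs0]

end Handle

section Cells

variable {ι : Type*}

/-- The open `ρ`-neighbourhood of the cell with lowest vertex `τ.1` and directions `τ.2` in the
cubical decomposition of `ι → ℝ`. -/
def cellNhd (τ : (ι → ℤ) × Finset ι) (ρ : ℝ) : Set (ι → ℝ) :=
  {x | ∀ l, τ.1 l - ρ < x l ∧ (l ∈ τ.2 → x l < τ.1 l + 1 + ρ) ∧ (l ∉ τ.2 → x l < τ.1 l + ρ)}

theorem cellNhd_mono {τ : (ι → ℤ) × Finset ι} {ρ ρ' : ℝ} (h : ρ ≤ ρ') :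
    cellNhd τ ρ ⊆ cellNhd τ ρ' := fun x hx l =>
  ⟨by linarith [(hx l).1], fun hl => by linarith [(hx l).2.1 hl],
    fun hl => by linarith [(hx l).2.2 hl]⟩

variable [Fintype ι] [DecidableEq ι]

/-- A family of cells is closed under passage to faces. -/
def FaceClosed (T : Set ((ι → ℤ) × Finset ι)) : Prop :=
  ∀ τ ∈ T, ∀ l ∈ τ.2, (τ.1, τ.2.erase l) ∈ T ∧
    (Function.update τ.1 l (τ.1 l + 1), τ.2.erase l) ∈ T

omit [Fintype ι] in
theorem mem_cellNhd_face {τ : (ι → ℤ) × Finset ι} {T : Set ((ι → ℤ) × Finset ι)} {ρ c : ℝ}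
    {l : ι} {x : ι → ℝ} (hl : l ∈ τ.2)
    (hT : (τ.1, τ.2.erase l) ∈ T ∧ (Function.update τ.1 l (τ.1 l + 1), τ.2.erase l) ∈ T)
    (hx : x ∈ cellNhd τ ρ) (hc : c < ρ) (hxl : 1 / 2 - c ≤ |x l - (τ.1 l + 1 / 2)|) :
    ∃ τ' ∈ T, x ∈ cellNhd τ' ρ := by
  have h0 := hx l
  have h1 := h0.2.1 hl
  rcases le_abs.1 hxl with h | h
  · refine ⟨_, hT.2, fun k => ?_⟩
    by_cases e : k = l
    · subst e
      simp only [Function.update_self, Finset.mem_erase, ne_eq, not_true_eq_false, false_and,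
        false_imp_iff, not_false_eq_true, true_imp_iff, true_and]
      push_cast
      constructor <;> linarith
    · have := hx k
      simpa [e] using this
  · refine ⟨_, hT.1, fun k => ?_⟩
    by_cases e : k = l
    · subst e
      simp only [Finset.mem_erase, ne_eq, not_true_eq_false, false_and,
        false_imp_iff, not_false_eq_true, true_imp_iff, true_and]
      constructor <;> linarith
    · have := hx k
      simpa [e] using this

omit [Fintype ι] [DecidableEq ι] in
/-- A point in the core of a cell is not close to other cells of at most the same dimension. -/
theorem cell_eq_of_mem {τ τ' : (ι → ℤ) × Finset ι} {ρ : ℝ} (hρ : ρ ≤ 1 / 4)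
    (hc : τ'.2.card ≤ τ.2.card) {x : ι → ℝ} (hx' : x ∈ cellNhd τ' ρ)
    (hx : ∀ l, (l ∈ τ.2 → τ.1 l + ρ ≤ x l ∧ x l ≤ τ.1 l + 1 - ρ) ∧
      (l ∉ τ.2 → |x l - τ.1 l| ≤ 1 / 4)) : τ' = τ := by
  obtain ⟨v, S⟩ := τ
  obtain ⟨v', S'⟩ := τ'
  have hS : S ⊆ S' := by
    intro l hl
    by_contra hl'
    have h1 := (hx l).1 hl
    have h2 := hx' l
    have h3 := h2.2.2 hl'
    simp only at h1 h2 h3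
    have a1 : (v l : ℝ) < v' l := by linarith
    have a2 : (v' l : ℝ) < v l + 1 := by linarith
    have b1 : v l < v' l := by exact_mod_cast a1
    have b2 : v' l < v l + 1 := by exact_mod_cast a2
    omega
  have hSS : S = S' := Finset.eq_of_subset_of_card_le hS hc
  subst hSS
  congr
  ext l
  have h2 := hx' l
  have hcast : ∀ {a b : ℤ}, (a : ℝ) < b + 1 → a ≤ b := fun {a b} h => by
    have : a < b + 1 := by exact_mod_cast h
    omega
  by_cases hl : l ∈ S
  · have h1 := (hx l).1 hl
    have h3 := h2.2.1 hl
    simp only at h1 h2 h3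
    exact le_antisymm (hcast (by linarith)) (hcast (by linarith))
  · have h1 := abs_le.1 ((hx l).2 hl)
    have h3 := h2.2.2 hl
    simp only at h1 h2 h3
    exact le_antisymm (hcast (by linarith)) (hcast (by linarith))

/-- Near-identity embeddings agree with global homeomorphisms near a finite family of cells, with
linear control. -/
def Extends (B : Set ι) (U : Set (ι → ℝ)) (T : Set ((ι → ℤ) × Finset ι)) : Prop :=
  ∃ ρ > 0, ρ ≤ 1 / 4 ∧ ∃ C > 0, ∃ δ₀ > 0, ∀ δ, 0 < δ → δ ≤ δ₀ → ∀ g : (ι → ℝ) → ι → ℝ,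
    NearEmb (orthant B) U g δ → ∃ G G', NearHomeo (orthant B) G G' (C * δ) ∧
      ∀ τ ∈ T, ∀ x ∈ orthant B, x ∈ cellNhd τ ρ → G x = g x

theorem extends_insert {B : Set ι} {U : Set (ι → ℝ)} {T : Set ((ι → ℤ) × Finset ι)}
    {τ : (ι → ℤ) × Finset ι} (hT : Extends B U T) (hτT : τ ∉ T)
    (hcard : ∀ τ' ∈ T, τ'.2.card ≤ τ.2.card)
    (hface : ∀ l ∈ τ.2, (τ.1, τ.2.erase l) ∈ T ∧
      (Function.update τ.1 l (τ.1 l + 1), τ.2.erase l) ∈ T)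
    (hτB : ∀ l ∈ B, 0 ≤ τ.1 l) (hτU : ∀ x ∈ orthant B, x ∈ cellNhd τ 1 → x ∈ U) :
    Extends B U (insert τ T) := by
  obtain ⟨ρ, hρ, hρ4, C, hC, δ₀, hδ₀, H⟩ := hT
  set F := τ.2ᶜ with hF
  have memF : ∀ l, l ∈ F ↔ l ∉ τ.2 := fun l => Finset.mem_compl
  set w : ℝ := 10 + 2 * F.card with hw
  have hw10 : 10 ≤ w := by
    have : (0 : ℝ) ≤ F.card := Nat.cast_nonneg _
    linarith
  set ζ : ℝ := ρ / (2 * w) with hζ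
  have hζ0 : 0 < ζ := by positivity
  have hζw : ζ * w = ρ / 2 := by rw [hζ]; field_simp
  have hζρ : ζ ≤ ρ / 20 := by nlinarith
  set e : ℝ := ρ / 8 with he
  set m : ι → ℝ := fun l => if l ∈ τ.2 then τ.1 l + 1 / 2 else τ.1 l with hm
  set s : ι → ℝ := fun l => if l ∈ τ.2 then 1 - ρ / 2 else ζ with hs
  have mS : ∀ l ∈ τ.2, m l = τ.1 l + 1 / 2 := fun l hl => if_pos hl
  have mF : ∀ l ∉ τ.2, m l = τ.1 l := fun l hl => if_neg hl
  have sS : ∀ l ∈ τ.2, s l = 1 - ρ / 2 := fun l hl => if_pos hl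
  have sF : ∀ l ∉ τ.2, s l = ζ := fun l hl => if_neg hl
  have hsσ : ∀ l, ζ ≤ s l := fun l => by
    by_cases hl : l ∈ τ.2
    · rw [sS l hl]; linarith
    · rw [sF l hl]
  have hs1 : ∀ l, s l ≤ 1 := fun l => by
    by_cases hl : l ∈ τ.2
    · rw [sS l hl]; linarith
    · rw [sF l hl]; linarith
  have hs0 : ∀ l, 0 < s l := fun l => hζ0.trans_le (hsσ l)
  have undiag_lt : ∀ (y : ι → ℝ) (l : ι) (c : ℝ), |undiag m s y l| < c ↔ |y l - m l| < c * s l := by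
    intro y l c
    rw [undiag, abs_div, abs_of_pos (hs0 l), div_lt_iff₀ (hs0 l)]
  have handle_sub : ∀ y : ι → ℝ, (∀ l, |undiag m s y l| < handleWidth F e l) →
      y ∈ cellNhd τ ρ := by
    intro y hy l
    have h := (undiag_lt _ _ _).1 (hy l)
    by_cases hl : l ∈ τ.2
    · rw [handleWidth_of_notMem (by simpa [memF] using hl), mS l hl, sS l hl, abs_lt] at h
      refine ⟨by nlinarith, fun _ => by nlinarith, fun h' => absurd hl h'⟩
    · rw [handleWidth_of_mem (by simpa [memF] using hl), mF l hl, sF l hl, abs_lt, ← hw,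
        mul_comm, hζw] at h
      refine ⟨by linarith, fun h' => absurd h' hl, fun _ => by linarith⟩
  have face_of : ∀ y ∈ cellNhd τ ρ, (∃ l ∉ F, 1 / 2 ≤ |undiag m s y l|) →
      ∃ τ' ∈ T, y ∈ cellNhd τ' ρ := by
    rintro y hy ⟨l, hl, h⟩
    have hl : l ∈ τ.2 := by simpa [memF] using hl
    have h1 : 1 / 2 * s l ≤ |y l - m l| := not_lt.1 fun h' => h.not_gt ((undiag_lt _ _ _).2 h')
    rw [mS l hl, sS l hl] at h1
    exact mem_cellNhd_face (c := ρ / 4) hl (hface l hl) hy (by linarith) (by linarith)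
  set N : ℝ := 9 ^ F.card with hN
  have hN1 : 1 ≤ N := one_le_pow₀ (by norm_num)
  refine ⟨ζ / 2, by positivity, by linarith, C + 4 * (N * ((C + 1) / ζ)), by positivity,
    min δ₀ (ζ * e / (100 * N * (C + 1))), by positivity, fun δ hδ hδ' g hg => ?_⟩
  obtain ⟨G₁, G₁', hG, hGg⟩ := H δ hδ (hδ'.trans (min_le_left _ _)) g hg
  have hδe : N * ((C + 1) * δ / ζ) ≤ e / 100 := by
    have h1 := hδ'.trans (min_le_right _ _)
    rw [le_div_iff₀ (by positivity)] at h1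
    rw [← mul_div_assoc, div_le_iff₀ hζ0]
    linarith
  have hδ1 : 0 < (C + 1) * δ := by positivity
  have hδe' : (C + 1) * δ / ζ ≤ e / 100 := by
    have : 0 < (C + 1) * δ / ζ := by positivity
    nlinarith
  have hδζ : (C + 1) * δ ≤ ζ * e := by
    rw [div_le_iff₀ hζ0] at hδe'
    nlinarith
  have hg₁ : NearEmb (orthant B) U (fun x => G₁' (g x)) ((C + 1) * δ) := by
    refine ⟨fun x hx hxU => ?_, fun x hx hxU => ?_, fun x hx hxU y hy hyU h => ?_⟩
    · have l := hg.loc x hx hxU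
      exact (hG.symm.locHomeoAt l.1).comp l
    · have h1 := hG.symm.near _ (hg.loc x hx hxU).1
      have h2 := hg.near x hx hxU
      have := dist_triangle (G₁' (g x)) (g x) x
      linarith
    · exact hg.inj x hx hxU y hy hyU
        (hG.symm.injOn (hg.loc x hx hxU).1 (hg.loc y hy hyU).1 h)
  have g₁_id : ∀ τ' ∈ T, ∀ x ∈ orthant B, x ∈ cellNhd τ' ρ → G₁' (g x) = x := by
    intro τ' hτ' x hx hxτ
    rw [← hGg τ' hτ' x hx hxτ, hG.left x hx]
  have hside : ∀ l ∈ B, m l ≠ 0 → (C + 1) * δ + s l * handleWidth F e l < m l := by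
    have hsm : ζ * e ≤ ρ / 160 := by nlinarith
    intro l hl hml
    have hv := hτB l hl
    by_cases hlS : l ∈ τ.2
    · rw [handleWidth_of_notMem (by simpa [memF] using hlS), mS l hlS, sS l hlS]
      have : (0 : ℝ) ≤ τ.1 l := by exact_mod_cast hv
      nlinarith
    · rw [handleWidth_of_mem (by simpa [memF] using hlS), sF l hlS, ← hw, hζw]
      rw [mF l hlS] at hml ⊢
      have h1 : τ.1 l ≠ 0 := by exact_mod_cast hml
      have : (1 : ℝ) ≤ τ.1 l := by exact_mod_cast (by omega : 1 ≤ τ.1 l)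
      nlinarith
  have hfix : ∀ y ∈ orthant B, (∀ l, |undiag m s y l| < handleWidth F e l) →
      (∃ l ∉ F, 1 / 2 ≤ |undiag m s y l|) → G₁' (g y) = y := by
    intro y hy hyO hyl
    obtain ⟨τ', hτ', hyτ⟩ := face_of y (handle_sub y hyO) hyl
    exact g₁_id τ' hτ' y hy hyτ
  obtain ⟨A, A', hA, hA1, hA2⟩ := NearEmb.exists_handle_diag (F := F) (m := m) (s := s) (e := e)
    hδ1 hζ0 hsσ hs1 (by linarith) (by linarith) (by linarith) hside
    (hg₁.mono (fun x hx h => hτU x hx (cellNhd_mono (by linarith) (handle_sub x h))) le_rfl) hfix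
  refine ⟨G₁ ∘ A, A' ∘ G₁', (hG.comp hA).mono (le_of_eq (by rw [← hN]; ring)), ?_⟩
  have on_handle : ∀ x ∈ orthant B, x ∈ U → (∀ l ∉ F, |undiag m s x l| < 1 / 2 + e) →
      (∀ l ∈ F, |undiag m s x l| < 1 / 2) → G₁ (A x) = g x := by
    intro x hx hxU h1 h2
    rw [hA2 x hx h1 h2, hG.right _ (hg.loc x hx hxU).1]
  have hN1' : ∀ x ∈ cellNhd τ (ζ / 2), ∀ l ∈ F, |undiag m s x l| < 1 / 2 := by
    intro x hx l hl
    have hl' := (memF l).1 hl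
    rw [undiag_lt, mF l hl', sF l hl', abs_lt]
    have := hx l
    have := this.2.2 hl'
    constructor <;> linarith
  have hxU : ∀ x ∈ orthant B, x ∈ cellNhd τ (ζ / 2) → x ∈ U := fun x hx h =>
    hτU x hx (cellNhd_mono (by linarith) h)
  rintro τ' (rfl | hτ') x hx hxτ
  · by_cases h : ∀ l ∉ F, |undiag m s x l| < 1 / 2 + e
    · exact on_handle x hx (hxU x hx hxτ) h (hN1' x hxτ)
    · push Not at h
      obtain ⟨l, hl, h⟩ := h
      have hl2 : ∃ l ∉ F, 1 / 2 ≤ |undiag m s x l| := ⟨l, hl, by linarith⟩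
      obtain ⟨τ'', h1, h2⟩ := face_of x (cellNhd_mono (by linarith) hxτ) hl2
      rw [Function.comp_apply, hA1 x hx (Or.inr hl2)]
      exact hGg τ'' h1 x hx h2
  · rw [Function.comp_apply, hA1 x hx]
    · exact hGg τ' hτ' x hx (cellNhd_mono (by linarith) hxτ)
    · by_contra! hcon
      refine hτT ?_
      rw [← cell_eq_of_mem (ρ := ρ / 4) (by linarith) (hcard τ' hτ')
        (cellNhd_mono (by linarith) hxτ) fun l => ⟨fun hl => ?_, fun hl => ?_⟩]
      · exact hτ'
      · have h := hcon.2 l (by simpa [memF] using hl)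
        rw [undiag_lt, mS l hl, sS l hl, abs_lt] at h
        constructor <;> linarith
      · have h := hcon.1 l (by simpa [memF] using hl)
        rw [undiag_lt, mF l hl, sF l hl] at h
        linarith

theorem extends_of_faceClosed {B : Set ι} {U : Set (ι → ℝ)} (T : Finset ((ι → ℤ) × Finset ι))
    (hT : FaceClosed (T : Set ((ι → ℤ) × Finset ι)))
    (hTB : ∀ τ ∈ T, (∀ l ∈ B, 0 ≤ τ.1 l) ∧ ∀ x ∈ orthant B, x ∈ cellNhd τ 1 → x ∈ U) :
    Extends B U (T : Set ((ι → ℤ) × Finset ι)) := by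
  classical
  induction T using Finset.induction_on_max_value (f := fun τ : (ι → ℤ) × Finset ι => τ.2.card) with
  | empty =>
    refine ⟨1 / 4, by norm_num, le_rfl, 1, one_pos, 1, one_pos, fun δ hδ _ g _ => ?_⟩
    exact ⟨_, _, NearHomeo.refl (by linarith), by simp⟩
  | insert τ T hτ hmax ih =>
    have hne : ∀ τ' : (ι → ℤ) × Finset ι, ∀ l ∈ τ'.2, τ'.2.card ≤ τ.2.card → ∀ v,
        (v, τ'.2.erase l) ∈ ((insert τ T : Finset _) : Set ((ι → ℤ) × Finset ι)) →
        (v, τ'.2.erase l) ∈ (T : Set ((ι → ℤ) × Finset ι)) := by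
      intro τ' l hl hc v h
      rw [Finset.coe_insert] at h
      refine h.resolve_left fun h' => ?_
      have h2 := congrArg (fun τ => τ.2.card) h'
      simp only [Finset.card_erase_of_mem hl] at h2
      have := Finset.card_pos.2 ⟨l, hl⟩
      omega
    rw [Finset.coe_insert]
    refine extends_insert (ih ?_ fun τ' h => hTB τ' (Finset.mem_insert_of_mem h))
      (by simpa using hτ) (by simpa using hmax) (fun l hl => ?_)
      (hTB τ (Finset.mem_insert_self _ _)).1 (hTB τ (Finset.mem_insert_self _ _)).2
    · intro τ' hτ' l hl
      have := hT τ' (by simp [Finset.mem_coe.1 hτ']) l hl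
      exact ⟨hne τ' l hl (hmax τ' hτ') _ this.1, hne τ' l hl (hmax τ' hτ') _ this.2⟩
    · have := hT τ (by simp) l hl
      exact ⟨hne τ l hl le_rfl _ this.1, hne τ l hl le_rfl _ this.2⟩

end Cells

section Homothety

variable {ι : Type*} [Fintype ι] {B : Set ι} {c : ℝ}

omit [Fintype ι] in
theorem locHomeoAt_homothety (hc : 0 < c) {x : ι → ℝ} (hx : x ∈ orthant B) :
    LocHomeoAt (orthant B) (orthant B) (fun y => c • y) x := by
  have key : ∀ a : ℝ, 0 < a → ∀ z : ι → ℝ,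
      Tendsto (fun y => a • y) (𝓝[orthant B] z) (𝓝[orthant B] (a • z)) := fun a ha z =>
    ((continuous_const_smul a).continuousWithinAt (s := orthant B)).tendsto_nhdsWithin
      (fun y hy => smul_orthant a ha y hy)
  refine .of_inverse (h := fun y => c⁻¹ • y) (key c hc x) (smul_orthant c hc x hx) ?_
    (Eventually.of_forall fun y => smul_inv_smul₀ hc.ne' y)
  simpa [inv_smul_smul₀ hc.ne'] using key c⁻¹ (inv_pos.2 hc) (c • x)

theorem dist_smul_left (hc : 0 < c) (x y : ι → ℝ) : dist (c • x) (c • y) = c * dist x y := by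
  rw [dist_smul₀, Real.norm_of_nonneg hc.le]

theorem NearEmb.homothety (hc : 0 < c) {U : Set (ι → ℝ)} {g : (ι → ℝ) → ι → ℝ} {δ : ℝ}
    (hg : NearEmb (orthant B) U g δ) :
    NearEmb (orthant B) {x | c⁻¹ • x ∈ U} (fun x => c • g (c⁻¹ • x)) (c * δ) := by
  have hX : ∀ x ∈ orthant B, c⁻¹ • x ∈ orthant B := fun x hx => smul_orthant _ (inv_pos.2 hc) x hx
  refine ⟨fun x hx hxU => ?_, fun x hx hxU => ?_, fun x hx hxU y hy hyU h => ?_⟩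
  · have l := hg.loc _ (hX x hx) hxU
    exact (locHomeoAt_homothety hc l.1).comp (g := fun x => g (c⁻¹ • x))
      (l.comp (locHomeoAt_homothety (inv_pos.2 hc) hx))
  · have h := hg.near _ (hX x hx) hxU
    calc dist (c • g (c⁻¹ • x)) x = dist (c • g (c⁻¹ • x)) (c • (c⁻¹ • x)) := by
          rw [smul_inv_smul₀ hc.ne']
      _ ≤ c * δ := by rw [dist_smul_left hc]; gcongr
  · have := hg.inj _ (hX x hx) hxU _ (hX y hy) hyU (smul_right_injective _ hc.ne' h)
    exact smul_right_injective _ (inv_pos.2 hc).ne' this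

theorem NearHomeo.homothety (hc : 0 < c) {G G' : (ι → ℝ) → ι → ℝ} {η : ℝ}
    (h : NearHomeo (orthant B) G G' η) :
    NearHomeo (orthant B) (fun x => c⁻¹ • G (c • x)) (fun x => c⁻¹ • G' (c • x)) (c⁻¹ * η) := by
  have hX : MapsTo (fun x : ι → ℝ => c • x) (orthant B) (orthant B) := smul_orthant c hc
  have hX' : MapsTo (fun x : ι → ℝ => c⁻¹ • x) (orthant B) (orthant B) :=
    smul_orthant _ (inv_pos.2 hc)
  have hcc : ContinuousOn (fun x : ι → ℝ => c • x) (orthant B) :=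
    (continuous_const_smul c).continuousOn
  refine ⟨hX'.comp (h.maps.comp hX), hX'.comp (h.maps'.comp hX), ?_, ?_, fun x hx => ?_,
    fun x hx => ?_, fun x hx => ?_⟩
  · exact (h.cont.comp hcc hX).const_smul c⁻¹
  · exact (h.cont'.comp hcc hX).const_smul c⁻¹
  · simp only [smul_inv_smul₀ hc.ne', h.left _ (hX hx), inv_smul_smul₀ hc.ne']
  · simp only [smul_inv_smul₀ hc.ne', h.right _ (hX hx), inv_smul_smul₀ hc.ne']
  · have h1 := h.near _ (hX hx)
    calc dist (c⁻¹ • G (c • x)) x = dist (c⁻¹ • G (c • x)) (c⁻¹ • (c • x)) := by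
          rw [inv_smul_smul₀ hc.ne']
      _ ≤ c⁻¹ * η := by rw [dist_smul_left (inv_pos.2 hc)]; gcongr

end Homothety

/-- An embedding close to the identity agrees on a compact subset of its domain with
a homeomorphism close to the identity. -/
theorem exists_nearHomeo_eqOn {ι : Type*} [Fintype ι] {B : Set ι} {K U : Set (ι → ℝ)}
    (hK : IsCompact K) (hKB : K ⊆ orthant B)
    (hKU : ∃ ε > 0, ∀ x ∈ K, ∀ y ∈ orthant B, dist y x < ε → y ∈ U) :
    ∃ C > 0, ∃ δ₀ > 0, ∀ δ, 0 < δ → δ ≤ δ₀ → ∀ g : (ι → ℝ) → ι → ℝ,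
      NearEmb (orthant B) U g δ → ∃ G G', NearHomeo (orthant B) G G' (C * δ) ∧
        ∀ x ∈ K, G x = g x := by
  classical
  obtain ⟨ε, hε, hKU⟩ := hKU
  set c : ℝ := 4 / ε with hc
  have hc0 : 0 < c := by positivity
  set T : Set ((ι → ℤ) × Finset ι) := {τ | (∀ l ∈ B, 0 ≤ τ.1 l) ∧ ∃ p ∈ K, ∀ l,
    |(τ.1 l : ℝ) - c * p l| ≤ 1 ∧ (l ∈ τ.2 → |(τ.1 l : ℝ) + 1 - c * p l| ≤ 1)} with hT
  have hTfin : T.Finite := by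
    obtain ⟨R, hR⟩ := hK.isBounded.subset_closedBall 0
    refine ((finite_Icc (fun _ => ⌊-(c * R + 1)⌋ : ι → ℤ) (fun _ => ⌈c * R + 1⌉)).prod
      (finite_univ : (univ : Set (Finset ι)).Finite)).subset ?_
    rintro ⟨v, S⟩ ⟨-, p, hp, h⟩
    have hv : ∀ l, |(v l : ℝ)| ≤ c * R + 1 := fun l => by
      have h1 := abs_le.1 (h l).1
      have h2 : |p l| ≤ R := (norm_le_pi_norm p l).trans (by simpa using hR hp)
      have h3 := abs_le.1 h2
      refine abs_le.2 ⟨?_, ?_⟩ <;> nlinarith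
    refine ⟨⟨fun l => ?_, fun l => ?_⟩, mem_univ _⟩
    · have : (⌊-(c * R + 1)⌋ : ℝ) ≤ v l := (Int.floor_le _).trans (abs_le.1 (hv l)).1
      exact_mod_cast this
    · have : (v l : ℝ) ≤ ⌈c * R + 1⌉ := (abs_le.1 (hv l)).2.trans (Int.le_ceil _)
      exact_mod_cast this
  have hface : FaceClosed T := by
    rintro ⟨v, S⟩ ⟨hB, p, hp, h⟩ l hl
    refine ⟨⟨hB, p, hp, fun k => ⟨(h k).1, fun hk => (h k).2 (Finset.mem_of_mem_erase hk)⟩⟩,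
      fun k hk => ?_, p, hp, fun k => ?_⟩
    · by_cases e : k = l
      · subst e
        have := hB k hk
        simp only [Function.update_self] at this ⊢
        omega
      · simpa [e] using hB k hk
    · by_cases e : k = l
      · subst e
        simpa using (h k).2 hl
      · simpa [e] using h k
  obtain ⟨ρ, hρ, -, C, hC, δ₀, hδ₀, H⟩ := extends_of_faceClosed (B := B) (U := {x | c⁻¹ • x ∈ U})
    hTfin.toFinset (by simpa using hface) (fun τ hτ => by
      obtain ⟨hB, p, hp, h⟩ := hTfin.mem_toFinset.1 hτ
      refine ⟨hB, fun x hx hxτ => hKU p hp _ (smul_orthant _ (inv_pos.2 hc0) x hx) ?_⟩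
      have hd : dist x (c • p) ≤ 2 := by
        refine (dist_pi_le_iff zero_le_two).2 fun l => ?_
        have h1 := hxτ l
        have h2 := abs_le.1 (h l).1
        rw [Real.dist_eq, Pi.smul_apply, smul_eq_mul, abs_le]
        refine ⟨by linarith, ?_⟩
        by_cases hl : l ∈ τ.2
        · have h3 := abs_le.1 ((h l).2 hl)
          have := h1.2.1 hl
          linarith
        · have := h1.2.2 hl
          linarith
      calc dist (c⁻¹ • x) p = dist (c⁻¹ • x) (c⁻¹ • (c • p)) := by rw [inv_smul_smul₀ hc0.ne']
        _ ≤ c⁻¹ * 2 := by rw [dist_smul_left (inv_pos.2 hc0)]; gcongr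
        _ < ε := by rw [hc, inv_div]; linarith)
  refine ⟨C, hC, δ₀ / c, by positivity, fun δ hδ hδ' g hg => ?_⟩
  obtain ⟨G, G', hG, hGg⟩ := H (c * δ) (by positivity)
    (by rwa [le_div_iff₀ hc0, mul_comm] at hδ') _ (hg.homothety hc0)
  refine ⟨_, _, (hG.homothety hc0).mono (by field_simp; rfl), fun x hx => ?_⟩
  have hxB : x ∈ orthant B := hKB hx
  have key := hGg (fun l => ⌊c * x l⌋, Finset.univ) (by
    refine hTfin.mem_toFinset.2 ⟨fun l hl => Int.floor_nonneg.2 (mul_nonneg hc0.le (hxB l hl)),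
      x, hx, fun l => ?_⟩
    have h1 := Int.floor_le (c * x l)
    have h2 := Int.lt_floor_add_one (c * x l)
    refine ⟨abs_le.2 ⟨?_, ?_⟩, fun _ => abs_le.2 ⟨?_, ?_⟩⟩ <;> dsimp only <;> linarith) (c • x)
    (smul_orthant c hc0 x hxB) (fun l => by
      have h1 := Int.floor_le (c * x l)
      have h2 := Int.lt_floor_add_one (c * x l)
      simp only [Pi.smul_apply, smul_eq_mul, Finset.mem_univ, not_true_eq_false, true_imp_iff,
        false_imp_iff, and_true]
      constructor <;> linarith)
  rw [key, inv_smul_smul₀ hc0.ne', inv_smul_smul₀ hc0.ne']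

section Chart

variable {ι : Type*} [Fintype ι]

/-- The part of the orthant inside the ball of radius `s` with centre `c`. -/
def dom (B : Set ι) (c : ι → ℝ) (s : ℝ) : Set (ι → ℝ) := orthant B ∩ ball c s

theorem dom_mono {B : Set ι} {c : ι → ℝ} {s s' : ℝ} (h : s ≤ s') : dom B c s ⊆ dom B c s' :=
  inter_subset_inter_right _ (ball_subset_ball h)

theorem dom_mem_nhdsWithin {B : Set ι} {c x : ι → ℝ} {s : ℝ} (hx : x ∈ dom B c s) :
    dom B c s ∈ 𝓝[orthant B] x :=
  inter_mem self_mem_nhdsWithin (mem_nhdsWithin_of_mem_nhds (isOpen_ball.mem_nhds hx.2))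

/-- `φ` is a parametrization of an open subset by the part of the orthant inside the ball of
radius `3` with centre `c`. -/
structure IsParam {M : Type*} [TopologicalSpace M] (B : Set ι) (c : ι → ℝ) (φ : (ι → ℝ) → M) :
    Prop where
  loc : ∀ x ∈ dom B c 3, LocHomeoAt (orthant B) univ φ x
  inj : InjOn φ (dom B c 3)

/-- The point `x`, seen in the cone over the ball of radius `3` with centre `c`. -/
noncomputable def coneCoord (c x : ι → ℝ) : ℝ × (ι → ℝ) :=
  (3 - dist x c, (3 - dist x c) • (x - c))

theorem continuous_coneCoord (c : ι → ℝ) : Continuous (coneCoord c) := by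
  unfold coneCoord
  fun_prop

theorem norm_coneCoord_le {c x : ι → ℝ} (h : dist x c < 3) :
    ‖coneCoord c x‖ ≤ 3 * (3 - dist x c) := by
  have h0 : 0 < 3 - dist x c := by linarith
  rw [coneCoord, Prod.norm_mk, max_le_iff, norm_smul, Real.norm_of_nonneg h0.le, ← dist_eq_norm]
  constructor <;> nlinarith

theorem dist_le_of_dist_coneCoord {c x y : ι → ℝ} {η : ℝ} (hx : dist x c ≤ 5 / 2)
    (hy : dist y c < 3) (h : dist (coneCoord c y) (coneCoord c x) < η) : dist y x ≤ 8 * η := by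
  rw [coneCoord, coneCoord, Prod.dist_eq, max_lt_iff] at h
  obtain ⟨h1, h2⟩ := h
  rw [Real.dist_eq] at h1
  rw [dist_eq_norm] at h2
  set a := 3 - dist x c with ha
  set b := 3 - dist y c with hb
  have ha0 : 1 / 2 ≤ a := by linarith
  have key : a • (y - x) = (b • (y - c) - a • (x - c)) + (a - b) • (y - c) := by module
  have h3 : a * dist y x ≤ η + η * 3 := by
    calc a * dist y x = ‖a • (y - x)‖ := by
          rw [norm_smul, Real.norm_of_nonneg (by linarith), dist_eq_norm]
      _ ≤ ‖b • (y - c) - a • (x - c)‖ + ‖(a - b) • (y - c)‖ := key ▸ norm_add_le _ _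
      _ ≤ η + η * 3 := by
          rw [norm_smul, Real.norm_eq_abs, ← dist_eq_norm y c, abs_sub_comm]
          exact add_le_add h2.le (mul_le_mul h1.le hy.le dist_nonneg (h1.le.trans' (abs_nonneg _)))
  have : 0 ≤ dist y x := dist_nonneg
  nlinarith

variable {M : Type*} [TopologicalSpace M] {B : Set ι} {c : ι → ℝ} {φ : (ι → ℝ) → M}

/-- The inverse of a parametrization. -/
noncomputable def chartInv (B : Set ι) (c : ι → ℝ) (φ : (ι → ℝ) → M) : M → ι → ℝ :=
  Function.invFunOn φ (dom B c 3)

open Classical in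
/-- A chart, extended to the whole space with values in a cone. -/
noncomputable def coneChart (B : Set ι) (c : ι → ℝ) (φ : (ι → ℝ) → M) (p : M) : ℝ × (ι → ℝ) :=
  if p ∈ φ '' dom B c 3 then coneCoord c (chartInv B c φ p) else 0

namespace IsParam

theorem chartInv_apply (h : IsParam B c φ) {x : ι → ℝ} (hx : x ∈ dom B c 3) :
    chartInv B c φ (φ x) = x := h.inj.leftInvOn_invFunOn hx

theorem coneChart_apply (h : IsParam B c φ) {x : ι → ℝ} (hx : x ∈ dom B c 3) :
    coneChart B c φ (φ x) = coneCoord c x := by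
  rw [coneChart, if_pos (mem_image_of_mem _ hx), h.chartInv_apply hx]

theorem continuousOn (h : IsParam B c φ) : ContinuousOn φ (dom B c 3) := fun x hx => by
  have := (h.loc x hx).tendsto
  rw [nhdsWithin_univ] at this
  exact this.mono_left (nhdsWithin_mono _ inter_subset_left)

theorem map_nhds (h : IsParam B c φ) {x : ι → ℝ} (hx : x ∈ dom B c 3) :
    map φ (𝓝[orthant B] x) = 𝓝 (φ x) := by
  rw [(h.loc x hx).2, nhdsWithin_univ]

theorem isCompact_image (h : IsParam B c φ) {s : ℝ} (hs : s < 3) :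
    IsCompact (φ '' (orthant B ∩ closedBall c s)) :=
  ((isCompact_closedBall c s).inter_left (isClosed_orthant B)).image_of_continuousOn
    (h.continuousOn.mono (inter_subset_inter_right _ (closedBall_subset_ball hs)))

theorem isOpen_image (h : IsParam B c φ) {s : ℝ} (hs : s ≤ 3) : IsOpen (φ '' dom B c s) := by
  rw [isOpen_iff_mem_nhds]
  rintro _ ⟨x, hx, rfl⟩
  rw [← h.map_nhds (dom_mono hs hx)]
  exact image_mem_map (dom_mem_nhdsWithin hx)

theorem continuous_coneChart [T2Space M] (h : IsParam B c φ) :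
    Continuous (coneChart B c φ) := by
  rw [continuous_iff_continuousAt]
  intro p
  by_cases hp : p ∈ φ '' dom B c 3
  · obtain ⟨x, hx, rfl⟩ := hp
    rw [ContinuousAt, ← h.map_nhds hx, tendsto_map'_iff, h.coneChart_apply hx]
    refine ((continuous_coneCoord c).continuousWithinAt (s := orthant B)).tendsto.congr' ?_
    filter_upwards [dom_mem_nhdsWithin hx] with y hy
    exact (h.coneChart_apply hy).symm
  · rw [ContinuousAt, Metric.tendsto_nhds]
    intro ε hε
    have hC : (φ '' (orthant B ∩ closedBall c (3 - ε / 4)))ᶜ ∈ 𝓝 p := by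
      refine (h.isCompact_image (by linarith)).isClosed.isOpen_compl.mem_nhds fun hp' => hp ?_
      exact image_mono (inter_subset_inter_right _ (closedBall_subset_ball (by linarith))) hp'
    filter_upwards [hC] with q hq
    rw [coneChart, coneChart, if_neg hp, dist_zero_right]
    by_cases hq' : q ∈ φ '' dom B c 3
    · rw [if_pos hq']
      obtain ⟨y, hy, rfl⟩ := hq'
      rw [h.chartInv_apply hy]
      have h1 := norm_coneCoord_le (mem_ball.1 hy.2)
      have h2 : 3 - ε / 4 < dist y c := by
        by_contra! h2
        exact hq ⟨y, ⟨hy.1, mem_closedBall.2 h2⟩, rfl⟩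
      linarith
    · simpa [if_neg hq'] using hε

/-- A point whose cone coordinates are close to those of a point well inside the chart is itself
in the chart. -/
theorem exists_of_dist_coneChart (h : IsParam B c φ) {x : ι → ℝ} {q : M} {η : ℝ} (hη : η ≤ 1 / 2)
    (hx : dist x c ≤ 5 / 2) (hq : dist (coneChart B c φ q) (coneCoord c x) < η) :
    ∃ y ∈ dom B c 3, φ y = q ∧ dist y x ≤ 8 * η ∧ |dist y c - dist x c| < η := by
  by_cases hq' : q ∈ φ '' dom B c 3
  · obtain ⟨y, hy, rfl⟩ := hq'
    rw [h.coneChart_apply hy] at hq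
    refine ⟨y, hy, rfl, dist_le_of_dist_coneCoord hx hy.2 hq, ?_⟩
    have h1 : dist (3 - dist y c) (3 - dist x c) < η := (le_max_left _ _).trans_lt hq
    rwa [Real.dist_eq, sub_sub_sub_cancel_left, abs_sub_comm] at h1
  · rw [coneChart, if_neg hq'] at hq
    have h1 : dist (0 : ℝ) (3 - dist x c) < η := (le_max_left _ _).trans_lt hq
    rw [Real.dist_eq, zero_sub, abs_neg] at h1
    have := le_abs_self (3 - dist x c)
    linarith

end IsParam

end Chart

theorem LocHomeoAt.of_comp {α β γ : Type*} [TopologicalSpace α] [TopologicalSpace β]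
    [TopologicalSpace γ] {X : Set α} {Y : Set β} {Z : Set γ} {g : α → β} {f : β → γ} {x : α}
    (hg : LocHomeoAt X Y g x) (h : LocHomeoAt X Z (f ∘ g) x) : LocHomeoAt Y Z f (g x) :=
  ⟨h.1, by rw [← hg.2, Filter.map_map, h.2]; rfl⟩

section Approx

variable {ι : Type*} [Fintype ι] {κ : Type*} {M M' : Type*} [TopologicalSpace M]
  [TopologicalSpace M']

/-- Two families of parametrizations have close coordinate changes. -/
def Close (B : Set ι) (c : κ → ι → ℝ) (φ : κ → (ι → ℝ) → M) (φ' : κ → (ι → ℝ) → M') (ε : ℝ) :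
    Prop :=
  ∀ i j, ∀ x ∈ orthant B ∩ closedBall (c j) (5 / 2),
    dist (coneChart B (c i) (φ i) (φ j x)) (coneChart B (c i) (φ' i) (φ' j x)) < ε

/-- `f` restricts to an open embedding of `W` which almost preserves the coordinates. -/
structure Approx (B : Set ι) (c : κ → ι → ℝ) (φ : κ → (ι → ℝ) → M) (φ' : κ → (ι → ℝ) → M')
    (W : Set M) (f : M → M') (η : ℝ) : Prop where
  loc : ∀ p ∈ W, LocHomeoAt univ univ f p
  inj : InjOn f W
  near : ∀ p ∈ W, ∀ i,
    dist (coneChart B (c i) (φ' i) (f p)) (coneChart B (c i) (φ i) p) < η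

end Approx

theorem Approx.nearEmb {ι : Type*} [Fintype ι] {κ : Type*} {M M' : Type*} [TopologicalSpace M]
    [TopologicalSpace M'] {B : Set ι} {c : κ → ι → ℝ} {φ : κ → (ι → ℝ) → M}
    {φ' : κ → (ι → ℝ) → M'} {W : Set M} {f : M → M'} {η : ℝ} (hf : Approx B c φ φ' W f η)
    (i : κ) (hφ : IsParam B (c i) (φ i)) (hφ' : IsParam B (c i) (φ' i)) (hη : η ≤ 1 / 2) :
    NearEmb (orthant B) {x | x ∈ ball (c i) (5 / 2) ∧ φ i x ∈ W}
      (fun x => chartInv B (c i) (φ' i) (f (φ i x))) (8 * η) := by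
  have hex : ∀ x ∈ orthant B, x ∈ ball (c i) (5 / 2) → φ i x ∈ W →
      ∃ y ∈ dom B (c i) 3, φ' i y = f (φ i x) ∧ dist y x ≤ 8 * η := by
    intro x hx hxb hxW
    have h := hf.near _ hxW i
    rw [hφ.coneChart_apply ⟨hx, ball_subset_ball (by norm_num) hxb⟩] at h
    obtain ⟨y, hy, h1, h2, -⟩ := hφ'.exists_of_dist_coneChart hη (mem_ball.1 hxb).le h
    exact ⟨y, hy, h1, h2⟩
  refine ⟨fun x hx hxU => ?_, fun x hx hxU => ?_, fun x hx hxU x' hx' hxU' h => ?_⟩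
  · obtain ⟨y, hy, h1, -⟩ := hex x hx hxU.1 hxU.2
    have l1 := hφ.loc x ⟨hx, ball_subset_ball (by norm_num) hxU.1⟩
    have l2 : LocHomeoAt univ (orthant B) (chartInv B (c i) (φ' i)) (f (φ i x)) := by
      rw [← h1]
      refine (hφ'.loc y hy).of_leftInverse hy.1 ?_
      filter_upwards [dom_mem_nhdsWithin hy] with z hz
      exact hφ'.chartInv_apply hz
    exact LocHomeoAt.comp (g := fun x => f (φ i x)) l2 ((hf.loc _ hxU.2).comp l1)
  · obtain ⟨y, hy, h1, h2⟩ := hex x hx hxU.1 hxU.2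
    rwa [← h1, hφ'.chartInv_apply hy]
  · obtain ⟨y, hy, h1, -⟩ := hex x hx hxU.1 hxU.2
    obtain ⟨y', hy', h1', -⟩ := hex x' hx' hxU'.1 hxU'.2
    rw [← h1, ← h1', hφ'.chartInv_apply hy, hφ'.chartInv_apply hy'] at h
    refine hφ.inj ⟨hx, ball_subset_ball (by norm_num) hxU.1⟩
      ⟨hx', ball_subset_ball (by norm_num) hxU'.1⟩ (hf.inj hxU.2 hxU'.2 ?_)
    rw [← h1, ← h1', h]

/-- Extension of an approximate open embedding over one more chart. -/
theorem exists_approx_union {ι : Type*} [Fintype ι] {κ : Type*} [Fintype κ] {M : Type*}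
    [TopologicalSpace M] [T2Space M] {B : Set ι} {c : κ → ι → ℝ} {φ : κ → (ι → ℝ) → M}
    (hφ : ∀ i, IsParam B (c i) (φ i)) (i : κ) {W D V : Set M} (hW : IsOpen W) (hD : IsClosed D)
    (hV : IsOpen V) (hWD : W ⊆ D) (hDV : D ⊆ V) {r η : ℝ} (hr : r < 2) (hη : 0 < η) :
    ∃ η' > 0, ∃ ε > 0, ∀ (M' : Type) [TopologicalSpace M'] (φ' : κ → (ι → ℝ) → M'),
      (∀ i, IsParam B (c i) (φ' i)) → Close B c φ φ' ε → ∀ f, Approx B c φ φ' V f η' →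
      ∃ f', Approx B c φ φ' (W ∪ φ i '' dom B (c i) r) f' η := by
  classical
  have hA : ∀ s, IsCompact (orthant B ∩ closedBall (c i) s) := fun s =>
    (isCompact_closedBall _ _).inter_left (isClosed_orthant B)
  have hA3 : ∀ s < 3, orthant B ∩ closedBall (c i) s ⊆ dom B (c i) 3 := fun s hs =>
    inter_subset_inter_right _ (closedBall_subset_ball hs)
  set K : Set (ι → ℝ) := (orthant B ∩ closedBall (c i) (11 / 5)) ∩ φ i ⁻¹' D with hKdef
  have hK : IsCompact K := (hA _).of_isClosed_subset
    (((hφ i).continuousOn.mono (hA3 _ (by norm_num))).preimage_isClosed_of_isClosed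
      (hA _).isClosed hD) inter_subset_left
  obtain ⟨C, hC, δ₀, hδ₀, H⟩ := exists_nearHomeo_eqOn (B := B) (K := K)
    (U := {x | x ∈ ball (c i) (5 / 2) ∧ φ i x ∈ V}) hK (fun x hx => hx.1.1) (by
      obtain ⟨u, hu, hu'⟩ := continuousOn_iff'.1 (hφ i).continuousOn V hV
      obtain ⟨ε, hε, hεu⟩ := hK.exists_thickening_subset_open hu (fun x hx =>
        (hu'.subset ⟨hDV hx.2, hA3 _ (by norm_num) hx.1⟩).1)
      refine ⟨min ε (3 / 10), by positivity, fun x hx y hy hyx => ?_⟩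
      have h1 : y ∈ ball (c i) (5 / 2) := by
        have h2 := mem_closedBall.1 hx.1.2
        have h3 := hyx.trans_le (min_le_right _ _)
        have := dist_triangle y x (c i)
        exact mem_ball.2 (by linarith)
      refine ⟨h1, (hu'.superset ⟨hεu ?_, hy, ball_subset_ball (by norm_num) h1⟩).1⟩
      exact mem_thickening_iff.2 ⟨x, hx, hyx.trans_le (min_le_left _ _)⟩)
  obtain ⟨δ₁, hδ₁, hunif⟩ : ∃ δ₁ > 0, ∀ x ∈ orthant B ∩ closedBall (c i) (5 / 2),
      ∀ y ∈ orthant B ∩ closedBall (c i) (5 / 2), dist x y < δ₁ → ∀ l,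
      dist (coneChart B (c l) (φ l) (φ i x)) (coneChart B (c l) (φ l) (φ i y)) < η / 2 := by
    have hc : ContinuousOn (fun x l => coneChart B (c l) (φ l) (φ i x))
        (orthant B ∩ closedBall (c i) (5 / 2)) :=
      continuousOn_pi.2 fun l => (hφ l).continuous_coneChart.comp_continuousOn
        ((hφ i).continuousOn.mono (hA3 _ (by norm_num)))
    obtain ⟨δ₁, hδ₁, h⟩ := Metric.uniformContinuousOn_iff.1
      ((hA _).uniformContinuousOn_of_continuous hc) (η / 2) (by positivity)
    exact ⟨δ₁, hδ₁, fun x hx y hy hxy l => (dist_le_pi_dist _ _ l).trans_lt (h x hx y hy hxy)⟩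
  obtain ⟨η', hη', h1, h2, h3, h4, h5⟩ : ∃ η' > 0, η' ≤ 1 / 20 ∧ η' ≤ η ∧ 8 * η' ≤ δ₀ ∧
      C * (8 * η') ≤ 1 / 20 ∧ C * (8 * η') < δ₁ := by
    have e : Tendsto (fun t : ℝ => C * (8 * t)) (𝓝[>] 0) (𝓝 0) := by
      have : Continuous fun t : ℝ => C * (8 * t) := by fun_prop
      simpa using (this.tendsto 0).mono_left nhdsWithin_le_nhds
    have e' : Tendsto (fun t : ℝ => 8 * t) (𝓝[>] 0) (𝓝 0) := by
      have : Continuous fun t : ℝ => 8 * t := by fun_prop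
      simpa using (this.tendsto 0).mono_left nhdsWithin_le_nhds
    have e'' : Tendsto (fun t : ℝ => t) (𝓝[>] 0) (𝓝 0) := nhdsWithin_le_nhds
    have h20 : (0 : ℝ) < 1 / 20 := by norm_num
    exact ((eventually_mem_nhdsWithin (a := (0 : ℝ)) (s := Ioi 0)).and
      ((e''.eventually_le_const h20).and ((e''.eventually_le_const hη).and
      ((e'.eventually_le_const hδ₀).and ((e.eventually_le_const h20).and
      (e.eventually_lt_const hδ₁)))))).exists
  refine ⟨η', hη', η / 2, by positivity, fun M' _ φ' hφ' hclose f hf => ?_⟩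
  obtain ⟨G, G', hG, hGK⟩ := H (8 * η') (by positivity) h3 _
    (hf.nearEmb i (hφ i) (hφ' i) (by linarith))
  have hGd : ∀ x ∈ orthant B, ∀ s, dist x (c i) ≤ s → dist (G x) (c i) ≤ s + 1 / 20 := by
    intro x hx s hs
    have := dist_triangle (G x) x (c i)
    have := hG.near x hx
    linarith
  have hG3 : ∀ x ∈ dom B (c i) (11 / 5), G x ∈ dom B (c i) 3 := fun x hx =>
    ⟨hG.maps hx.1, mem_ball.2 (by linarith [hGd x hx.1 _ (mem_ball.1 hx.2).le])⟩
  have hfK : ∀ x ∈ K, φ' i (G x) = f (φ i x) := by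
    intro x hx
    have h := hf.near _ (hDV hx.2) i
    rw [(hφ i).coneChart_apply (hA3 _ (by norm_num) hx.1)] at h
    obtain ⟨y, hy, hyx, -⟩ := (hφ' i).exists_of_dist_coneChart (by linarith)
      ((mem_closedBall.1 hx.1.2).trans (by norm_num)) h
    rw [hGK x hx, ← hyx, (hφ' i).chartInv_apply hy]
  set f' : M → M' := fun p =>
    if p ∈ φ i '' dom B (c i) 2 then φ' i (G (chartInv B (c i) (φ i) p)) else f p with hf'
  have hf'φ : ∀ x ∈ dom B (c i) 2, f' (φ i x) = φ' i (G x) := by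
    intro x hx
    simp only [hf']
    rw [if_pos (mem_image_of_mem _ hx), (hφ i).chartInv_apply (dom_mono (by norm_num) hx)]
  have hf'W : ∀ p ∈ W, f' p = f p := by
    intro p hp
    by_cases h : p ∈ φ i '' dom B (c i) 2
    · obtain ⟨x, hx, rfl⟩ := h
      rw [hf'φ x hx, hfK x ⟨⟨hx.1, ball_subset_closedBall (ball_subset_ball (by norm_num) hx.2)⟩,
        hWD hp⟩]
    · simp only [hf', if_neg h]
  have hWV : W ⊆ V := hWD.trans hDV
  have hr2 : dom B (c i) r ⊆ dom B (c i) 2 := dom_mono hr.le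
  have h2' : dom B (c i) 2 ⊆ dom B (c i) (11 / 5) := dom_mono (by norm_num)
  have hinj : ∀ p ∈ W, ∀ y ∈ dom B (c i) r, f p = φ' i (G y) → p = φ i y := by
    intro p hp y hy h
    have hGy := hG3 y (h2' (hr2 hy))
    have hn := hf.near p (hWV hp) i
    rw [h, (hφ' i).coneChart_apply hGy, dist_comm] at hn
    have hGy' := hGd y hy.1 _ (mem_ball.1 hy.2).le
    obtain ⟨x, hx, rfl, -, hxy⟩ := (hφ i).exists_of_dist_coneChart (by linarith) (by linarith) hn
    have hx' : dist x (c i) < 11 / 5 := by linarith [le_abs_self (dist x (c i) - dist (G y) (c i))]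
    rw [← hfK x ⟨⟨hx.1, mem_closedBall.2 hx'.le⟩, hWD hp⟩] at h
    rw [hG.injOn hx.1 hy.1 ((hφ' i).inj (hG3 x ⟨hx.1, mem_ball.2 hx'⟩) hGy h)]
  refine ⟨f', ?_, ?_, ?_⟩
  · rintro p (hp | ⟨x, hx, rfl⟩)
    · refine (hf.loc p (hWV hp)).congr (mem_univ _) ?_
      rw [nhdsWithin_univ]
      exact eventually_of_mem (hW.mem_nhds hp) hf'W
    · have hx2 := hr2 hx
      refine ((hφ i).loc x (dom_mono (by norm_num) hx2)).of_comp ?_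
      refine (((hφ' i).loc _ (hG3 x (h2' hx2))).comp (hG.locHomeoAt hx.1)).congr hx.1 ?_
      filter_upwards [dom_mem_nhdsWithin hx2] with y hy
      exact hf'φ y hy
  · rintro p (hp | ⟨x, hx, rfl⟩) q (hq | ⟨y, hy, rfl⟩) h
    · rw [hf'W p hp, hf'W q hq] at h
      exact hf.inj (hWV hp) (hWV hq) h
    · rw [hf'W p hp, hf'φ y (hr2 hy)] at h
      exact hinj p hp y hy h
    · rw [hf'W q hq, hf'φ x (hr2 hx)] at h
      exact (hinj q hq x hx h.symm).symm
    · rw [hf'φ x (hr2 hx), hf'φ y (hr2 hy)] at h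
      rw [hG.injOn hx.1 hy.1
        ((hφ' i).inj (hG3 x (h2' (hr2 hx))) (hG3 y (h2' (hr2 hy))) h)]
  · rintro p (hp | ⟨x, hx, rfl⟩) l
    · rw [hf'W p hp]
      exact (hf.near p (hWV hp) l).trans_le h2
    · rw [hf'φ x (hr2 hx)]
      have hx2 := (mem_ball.1 (hr2 hx).2).le
      have hGx : G x ∈ orthant B ∩ closedBall (c i) (5 / 2) :=
        ⟨hG.maps hx.1, mem_closedBall.2 (by linarith [hGd x hx.1 _ hx2])⟩
      have e1 := hclose l i (G x) hGx
      have e2 := hunif (G x) hGx x ⟨hx.1, mem_closedBall.2 (by linarith)⟩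
        ((hG.near x hx.1).trans_lt h5) l
      rw [dist_comm] at e1
      linarith [dist_triangle (coneChart B (c l) (φ' l) (φ' i (G x)))
        (coneChart B (c l) (φ l) (φ i (G x))) (coneChart B (c l) (φ l) (φ i x))]

section Stability

variable {ι : Type*} [Fintype ι] {κ : Type*} [Fintype κ] {B : Set ι} {c : κ → ι → ℝ}

theorem exists_approx {M : Type*} [TopologicalSpace M] [T2Space M] {φ : κ → (ι → ℝ) → M}
    (hφ : ∀ i, IsParam B (c i) (φ i)) (s : Finset κ) : ∀ {r η : ℝ}, r < 2 → 0 < η →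
    ∃ ε > 0, ∀ (M' : Type) [TopologicalSpace M'] [Nonempty M'] (φ' : κ → (ι → ℝ) → M'),
      (∀ i, IsParam B (c i) (φ' i)) → Close B c φ φ' ε →
      ∃ f, Approx B c φ φ' (⋃ i ∈ s, φ i '' dom B (c i) r) f η := by
  classical
  induction s using Finset.induction_on with
  | empty =>
    refine fun _ _ => ⟨1, one_pos, fun M' _ _ φ' _ _ => ⟨fun _ => Classical.arbitrary M', ?_⟩⟩
    constructor <;> simp
  | insert i s _ ih =>
    intro r η hr hη
    set W : ℝ → Set M := fun t => ⋃ i ∈ s, φ i '' dom B (c i) t with hW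
    set b := (r + 2) / 2 with hb
    set d := (b + 2) / 2 with hd
    have hWo : ∀ t ≤ 3, IsOpen (W t) := fun t ht =>
      isOpen_biUnion fun j _ => (hφ j).isOpen_image ht
    obtain ⟨η', hη', ε₁, hε₁, H₁⟩ := exists_approx_union hφ i (W := W r)
      (D := ⋃ i ∈ s, φ i '' (orthant B ∩ closedBall (c i) b)) (V := W d)
      (hWo r (by linarith))
      (s.isCompact_biUnion fun j _ => (hφ j).isCompact_image (by linarith)).isClosed
      (hWo d (by linarith))
      (iUnion₂_mono fun j _ => image_mono (inter_subset_inter_right _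
        (ball_subset_closedBall.trans (closedBall_subset_closedBall (by linarith)))))
      (iUnion₂_mono fun j _ => image_mono (inter_subset_inter_right _
        (closedBall_subset_ball (by linarith)))) hr hη
    obtain ⟨ε₂, hε₂, H₂⟩ := ih (r := d) (by linarith) hη'
    refine ⟨min ε₁ ε₂, lt_min hε₁ hε₂, fun M' _ _ φ' hφ' hc => ?_⟩
    obtain ⟨f, hf⟩ := H₂ M' φ' hφ' fun i j x hx => (hc i j x hx).trans_le (min_le_right _ _)
    obtain ⟨f', hf'⟩ := H₁ M' φ' hφ' (fun i j x hx => (hc i j x hx).trans_le (min_le_left _ _)) f hf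
    refine ⟨f', ?_⟩
    rwa [Finset.set_biUnion_insert, union_comm]

/-- Compact manifolds with sufficiently close coordinate changes are homeomorphic. -/
theorem exists_homeomorph_of_close {M : Type*} [TopologicalSpace M] [T2Space M] [CompactSpace M]
    {φ : κ → (ι → ℝ) → M} (hφ : ∀ i, IsParam B (c i) (φ i))
    (hcov : ∀ p, ∃ i, p ∈ φ i '' dom B (c i) 1) :
    ∃ ε > 0, ∀ (M' : Type) [TopologicalSpace M'] [T2Space M'] (φ' : κ → (ι → ℝ) → M'),
      (∀ i, IsParam B (c i) (φ' i)) → (∀ p, ∃ i, p ∈ φ' i '' dom B (c i) 1) →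
      Close B c φ φ' ε → Nonempty (M ≃ₜ M') := by
  obtain ⟨ε, hε, H⟩ := exists_approx hφ Finset.univ (r := 3 / 2) (η := 1 / 2) (by norm_num)
    (by norm_num)
  refine ⟨ε, hε, fun M' _ _ φ' hφ' hcov' hc => ?_⟩
  rcases isEmpty_or_nonempty κ with hκ | ⟨⟨i₀⟩⟩
  · have : IsEmpty M := ⟨fun p => hκ.elim (hcov p).choose⟩
    have : IsEmpty M' := ⟨fun p => hκ.elim (hcov' p).choose⟩
    exact ⟨Homeomorph.empty⟩
  have : Nonempty M' := ⟨φ' i₀ 0⟩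
  obtain ⟨f, hf⟩ := H M' φ' hφ' hc
  have hmem : ∀ p, p ∈ ⋃ i ∈ Finset.univ, φ i '' dom B (c i) (3 / 2) := fun p => by
    obtain ⟨i, hi⟩ := hcov p
    exact mem_iUnion₂.2 ⟨i, Finset.mem_univ _, image_mono (dom_mono (by norm_num)) hi⟩
  have hmap : ∀ p, map f (𝓝 p) = 𝓝 (f p) := fun p => by
    simpa only [nhdsWithin_univ] using (hf.loc p (hmem p)).2
  have hcont : Continuous f := continuous_iff_continuousAt.2 fun p => (hmap p).le
  have hopen : IsOpenMap f := isOpenMap_iff_nhds_le.2 fun p => (hmap p).ge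
  have hclopen : IsClopen (range f) :=
    ⟨(isCompact_range hcont).isClosed, hopen.isOpen_range⟩
  have hinj : Function.Injective f := fun p q h => hf.inj (hmem p) (hmem q) h
  have hsurj : Function.Surjective f := by
    intro q
    obtain ⟨i, y, hy, rfl⟩ := hcov' q
    have hconn : IsPreconnected (φ' i '' dom B (c i) 3) :=
      ((convex_orthant B).inter (convex_ball _ _)).isPreconnected.image _ (hφ' i).continuousOn
    have hy3 := dom_mono (by norm_num : (1 : ℝ) ≤ 3) hy
    have hn := hf.near _ (hmem (φ i y)) i
    rw [(hφ i).coneChart_apply hy3] at hn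
    obtain ⟨z, hz, hzf, -⟩ := (hφ' i).exists_of_dist_coneChart le_rfl
      ((mem_ball.1 hy.2).le.trans (by norm_num)) hn
    exact hconn.subset_isClopen hclopen ⟨_, mem_image_of_mem _ hz, hzf ▸ mem_range_self _⟩
      (mem_image_of_mem _ hy3)
  exact ⟨(Equiv.ofBijective f ⟨hinj, hsurj⟩).toHomeomorphOfContinuousOpen hcont hopen⟩

end Stability

/-- The retraction of `ℝ⁴` onto the half-space. -/
def toHalfSpace (x : Fin 4 → ℝ) : EuclideanHalfSpace 4 :=
  ⟨WithLp.toLp 2 (Function.update x 0 (max (x 0) 0)), by simp⟩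

theorem continuous_toHalfSpace : Continuous toHalfSpace := by
  refine Continuous.subtype_mk ((PiLp.continuous_toLp 2 _).comp ?_) _
  exact continuous_id.update 0 ((continuous_apply 0).max continuous_const)

/-- The coordinates of a point of the half-space. -/
def ofHalfSpace (y : EuclideanHalfSpace 4) : Fin 4 → ℝ := fun i => y.1 i

theorem continuous_ofHalfSpace : Continuous ofHalfSpace := by
  unfold ofHalfSpace
  fun_prop

theorem ofHalfSpace_mem (y : EuclideanHalfSpace 4) : ofHalfSpace y ∈ orthant ({0} : Set (Fin 4)) := by
  rintro i rfl
  exact y.2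

theorem toHalfSpace_ofHalfSpace (y : EuclideanHalfSpace 4) : toHalfSpace (ofHalfSpace y) = y := by
  apply Subtype.ext
  ext i
  by_cases h : i = 0
  · subst h
    simp [toHalfSpace, ofHalfSpace, max_eq_left y.2]
  · simp [toHalfSpace, ofHalfSpace, h]

theorem ofHalfSpace_toHalfSpace {x : Fin 4 → ℝ} (hx : x ∈ orthant ({0} : Set (Fin 4))) :
    ofHalfSpace (toHalfSpace x) = x := by
  ext i
  by_cases h : i = 0
  · subst h
    simp [toHalfSpace, ofHalfSpace, max_eq_left (hx 0 rfl)]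
  · simp [toHalfSpace, ofHalfSpace, h]

theorem locHomeoAt_toHalfSpace {x : Fin 4 → ℝ} (hx : x ∈ orthant ({0} : Set (Fin 4))) :
    LocHomeoAt (orthant {0}) univ toHalfSpace x := by
  refine .of_inverse (h := ofHalfSpace) ?_ (mem_univ _) ?_
    (Eventually.of_forall toHalfSpace_ofHalfSpace)
  · rw [nhdsWithin_univ]
    exact continuous_toHalfSpace.continuousAt.continuousWithinAt
  · have := (continuous_ofHalfSpace.continuousWithinAt (s := univ)
      (x := toHalfSpace x)).tendsto_nhdsWithin (t := orthant {0}) fun y _ => ofHalfSpace_mem y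
    rwa [ofHalfSpace_toHalfSpace hx] at this

theorem exists_isParam {M : Type*} [TopologicalSpace M] [ChartedSpace (EuclideanHalfSpace 4) M]
    (p : M) : ∃ (m : ℕ) (φ : (Fin 4 → ℝ) → M),
      IsParam {0} (TopologicalSpace.denseSeq (Fin 4 → ℝ) m) φ ∧
        p ∈ φ '' dom {0} (TopologicalSpace.denseSeq (Fin 4 → ℝ) m) 1 := by
  set e := chartAt (EuclideanHalfSpace 4) p with he
  have hp : p ∈ e.source := mem_chart_source _ p
  set x₀ := ofHalfSpace (e p) with hx₀
  obtain ⟨s, hs, hsub⟩ := Metric.isOpen_iff.1 (e.open_target.preimage continuous_toHalfSpace) x₀ (by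
    rw [mem_preimage, hx₀, toHalfSpace_ofHalfSpace]
    exact e.map_source hp)
  set a : ℝ := 4 / s with ha
  have ha0 : 0 < a := by positivity
  obtain ⟨m, hm⟩ := (TopologicalSpace.denseRange_denseSeq (Fin 4 → ℝ)).exists_dist_lt (a • x₀)
    one_pos
  have htgt : ∀ x ∈ dom {0} (TopologicalSpace.denseSeq (Fin 4 → ℝ) m) 3,
      toHalfSpace (a⁻¹ • x) ∈ e.target := by
    intro x hx
    refine hsub (mem_ball.2 ?_)
    have h1 : dist x (a • x₀) < 4 := by
      have := dist_triangle_right x (a • x₀) (TopologicalSpace.denseSeq (Fin 4 → ℝ) m)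
      linarith [mem_ball.1 hx.2]
    calc dist (a⁻¹ • x) x₀ = dist (a⁻¹ • x) (a⁻¹ • (a • x₀)) := by rw [inv_smul_smul₀ ha0.ne']
      _ = a⁻¹ * dist x (a • x₀) := dist_smul_left (inv_pos.2 ha0) _ _
      _ < a⁻¹ * 4 := by gcongr
      _ = s := by rw [ha]; field_simp
  have hX : ∀ x ∈ orthant ({0} : Set (Fin 4)), a⁻¹ • x ∈ orthant ({0} : Set (Fin 4)) :=
    fun x hx => smul_orthant _ (inv_pos.2 ha0) x hx
  refine ⟨m, fun x => e.symm (toHalfSpace (a⁻¹ • x)), ⟨fun x hx => ?_, fun x hx y hy h => ?_⟩,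
    a • x₀, ⟨smul_orthant a ha0 x₀ (ofHalfSpace_mem _), mem_ball.2 hm⟩, ?_⟩
  · have l : LocHomeoAt univ univ e.symm (toHalfSpace (a⁻¹ • x)) := by
      refine ⟨mem_univ _, ?_⟩
      rw [nhdsWithin_univ, nhdsWithin_univ]
      exact e.symm.map_nhds_eq (htgt x hx)
    exact LocHomeoAt.comp (g := fun x => toHalfSpace (a⁻¹ • x)) l
      ((locHomeoAt_toHalfSpace (hX x hx.1)).comp (locHomeoAt_homothety (inv_pos.2 ha0) hx.1))
  · have h1 := congrArg ofHalfSpace (e.symm.injOn (htgt x hx) (htgt y hy) h)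
    rw [ofHalfSpace_toHalfSpace (hX x hx.1), ofHalfSpace_toHalfSpace (hX y hy.1)] at h1
    exact smul_right_injective _ (inv_pos.2 ha0).ne' h1
  · simp only [inv_smul_smul₀ ha0.ne', hx₀, toHalfSpace_ofHalfSpace, e.left_inv hp]

/-- A compact 4-manifold with a finite family of parametrizations with prescribed centres. -/
structure ParamManifold {k : ℕ} (m : Fin k → ℕ) where
  manifold : CompactTopFourManifold
  param : Fin k → (Fin 4 → ℝ) → manifold.carrier
  isParam : ∀ i, IsParam {0} (TopologicalSpace.denseSeq (Fin 4 → ℝ) (m i)) (param i)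
  cover : ∀ p, ∃ i, p ∈ param i '' dom {0} (TopologicalSpace.denseSeq (Fin 4 → ℝ) (m i)) 1

theorem exists_paramManifold (M : CompactTopFourManifold) :
    ∃ (q : Σ k : ℕ, Fin k → ℕ) (P : ParamManifold q.2), P.manifold = M := by
  choose m φ hφ hp using fun p : M.carrier => exists_isParam p
  obtain ⟨t, ht⟩ := isCompact_univ.elim_nhds_subcover (X := M.carrier)
    (fun p => φ p '' dom {0} (TopologicalSpace.denseSeq (Fin 4 → ℝ) (m p)) 1)
    (fun p _ => ((hφ p).isOpen_image (by norm_num)).mem_nhds (hp p))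
  let e := t.equivFin.symm
  refine ⟨⟨t.card, fun i => m (e i)⟩, ⟨M, fun i => φ (e i), fun i => hφ _, fun p => ?_⟩, rfl⟩
  obtain ⟨q, hq, hpq⟩ := mem_iUnion₂.1 (ht.2 (mem_univ p))
  exact ⟨e.symm ⟨q, hq⟩, by simpa using hpq⟩

/-- The part of the orthant inside the closed ball of radius `5 / 2` with centre `c`. -/
def closedDom {ι : Type*} [Fintype ι] (B : Set ι) (c : ι → ℝ) :
    TopologicalSpace.Compacts (ι → ℝ) :=
  ⟨orthant B ∩ closedBall c (5 / 2), (isCompact_closedBall _ _).inter_left (isClosed_orthant B)⟩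

theorem closedDom_subset {ι : Type*} [Fintype ι] (B : Set ι) (c : ι → ℝ) :
    (closedDom B c : Set (ι → ℝ)) ⊆ dom B c 3 :=
  inter_subset_inter_right _ (closedBall_subset_ball (by norm_num))

namespace ParamManifold

variable {k : ℕ} {m : Fin k → ℕ}

/-- The coordinate changes of a manifold with parametrizations. -/
noncomputable def transition (P : ParamManifold m) (i j : Fin k) :
    C(closedDom {0} (TopologicalSpace.denseSeq (Fin 4 → ℝ) (m j)), ℝ × (Fin 4 → ℝ)) where
  toFun x := coneChart {0} (TopologicalSpace.denseSeq (Fin 4 → ℝ) (m i)) (P.param i) (P.param j x)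
  continuous_toFun := by
    have h := (P.isParam j).continuousOn.mono (closedDom_subset _ _)
    exact (P.isParam i).continuous_coneChart.comp (continuousOn_iff_continuous_domRestrict.1 h)

theorem exists_homeomorph (P : ParamManifold m) : ∃ ε > 0, ∀ P' : ParamManifold m,
    dist P'.transition P.transition < ε →
      Nonempty (P.manifold.carrier ≃ₜ P'.manifold.carrier) := by
  obtain ⟨ε, hε, H⟩ := exists_homeomorph_of_close P.isParam P.cover
  refine ⟨ε, hε, fun P' h => H _ P'.param P'.isParam P'.cover fun i j x hx => ?_⟩
  rw [dist_comm] at h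
  have h1 := (dist_le_pi_dist P.transition P'.transition i).trans_lt h
  have h2 := (dist_le_pi_dist (P.transition i) (P'.transition i) j).trans_lt h1
  exact (ContinuousMap.dist_apply_le_dist (f := P.transition i j) (g := P'.transition i j)
    ⟨x, hx⟩).trans_lt h2

theorem exists_countable (m : Fin k → ℕ) : ∃ T : Set (ParamManifold m), T.Countable ∧
    ∀ P' : ParamManifold m, ∃ P ∈ T, Nonempty (P.manifold.carrier ≃ₜ P'.manifold.carrier) := by
  let : TopologicalSpace (ParamManifold m) := .induced transition inferInstance
  have : SecondCountableTopology (ParamManifold m) :=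
    TopologicalSpace.secondCountableTopology_induced _ _ _
  choose ε hε H using fun P : ParamManifold m => P.exists_homeomorph
  obtain ⟨T, hT, hTU⟩ := TopologicalSpace.countable_cover_nhds
    (f := fun P : ParamManifold m => transition ⁻¹' ball P.transition (ε P))
    fun P => continuous_induced_dom.continuousAt.preimage_mem_nhds (ball_mem_nhds _ (hε P))
  refine ⟨T, hT, fun P' => ?_⟩
  obtain ⟨P, hP, h⟩ := mem_iUnion₂.1 (hTU.superset (mem_univ P'))
  exact ⟨P, hP, H P P' h⟩

end ParamManifold

end TopologicalStability

/-- There are at most countably many homeomorphism types of compact topological 4-manifolds: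
there is a sequence of compact topological 4-manifolds such that every compact topological
4-manifold is homeomorphic to one of them. -/
theorem countable_homeomorphism_types_of_compact_four_manifolds :
    ∃ X : ℕ → CompactTopFourManifold,
      ∀ M : CompactTopFourManifold, ∃ n : ℕ, Nonempty (M.carrier ≃ₜ (X n).carrier) := by
  choose T hT H using fun q : Σ k : ℕ, Fin k → ℕ => TopologicalStability.ParamManifold.exists_countable q.2
  let := ChartedSpace.empty (EuclideanHalfSpace 4) Empty
  have hS : (⋃ q, TopologicalStability.ParamManifold.manifold '' T q).Countable :=
    Set.countable_iUnion fun q => (hT q).image _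
  obtain ⟨X, hX⟩ := (hS.insert ⟨Empty⟩).exists_eq_range (Set.insert_nonempty _ _)
  refine ⟨X, fun M => ?_⟩
  obtain ⟨q, P', rfl⟩ := TopologicalStability.exists_paramManifold M
  obtain ⟨P, hP, ⟨h⟩⟩ := H q P'
  obtain ⟨n, hn⟩ := hX.subset (Set.mem_insert_of_mem _ (Set.mem_iUnion.2 ⟨q, Set.mem_image_of_mem _ hP⟩))
  exact ⟨n, hn ▸ ⟨h.symm⟩⟩
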